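/- arXiv:1602.06217 — 4 statements merged into one kernel-verified Lean document; each statement's English description precedes it below -/
import Mathlib

section
/- Suppose ρ = 1 and α > 0. Then the average Z_n converges almost surely to a random variable Z with values in [0,1], and P(Z ∈ {0,1}) = 1 if and only if Σ_n r_n² = +∞. -/
open MeasureTheory Filter Real

noncomputable section

/-- The σ-field `F_n = σ(Z_k(i) : 1 ≤ i ≤ N, 0 ≤ k ≤ n)` generated by the walks up to time `n`. -/
def walkFiltration {Ω : Type*} [MeasurableSpace Ω] {N : ℕ}
    (Z : ℕ → Fin N → Ω → ℝ) (n : ℕ) : MeasurableSpace Ω :=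
  ⨆ k ∈ Finset.range (n + 1), ⨆ i : Fin N, MeasurableSpace.comap (Z k i) (borel ℝ)

/-- The empirical mean `Z_n = N⁻¹ Σ_{i=1}^N Z_n(i)`. -/
def walkMean {Ω : Type*} {N : ℕ} (Z : ℕ → Fin N → Ω → ℝ) (n : ℕ) (ω : Ω) : ℝ :=
  (∑ i : Fin N, Z n i ω) / N

theorem aux_int {Ω : Type*} {m m0 : MeasurableSpace Ω} (μ : Measure Ω) [IsProbabilityMeasure μ]
    (hm : m ≤ m0) (g h : Ω → ℝ) (hc : μ[g | m] =ᵐ[μ] h) : ∫ ω, g ω ∂μ = ∫ ω, h ω ∂μ := by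
  rw [← integral_condExp hm, integral_congr_ae hc]

theorem aux_int_mul {Ω : Type*} {m m0 : MeasurableSpace Ω} (μ : Measure Ω)
    [IsProbabilityMeasure μ]
    (hm : m ≤ m0) (f g h : Ω → ℝ) (hf : StronglyMeasurable[m] f)
    (hg : Integrable g μ) (hfg : Integrable (fun ω => f ω * g ω) μ)
    (hc : μ[g | m] =ᵐ[μ] h) : ∫ ω, f ω * g ω ∂μ = ∫ ω, f ω * h ω ∂μ := by
  refine aux_int μ hm _ _ ?_
  have h1 := condExp_mul_of_stronglyMeasurable_left (μ := μ) hf hfg hg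
  refine h1.trans ?_
  filter_upwards [hc] with ω hω
  simp [hω]

theorem aux_bdd {Ω : Type*} [MeasurableSpace Ω] (μ : Measure Ω) [IsProbabilityMeasure μ]
    (f : Ω → ℝ) (hf : Measurable f) (h : ∀ ω, f ω ∈ Set.Icc (0:ℝ) 1) : Integrable f μ := by
  refine Integrable.of_bound hf.aestronglyMeasurable 1 (Eventually.of_forall fun ω => ?_)
  rw [Real.norm_eq_abs, abs_of_nonneg (h ω).1]
  exact (h ω).2

theorem aux_mul {a b : ℝ} (ha : a ∈ Set.Icc (0:ℝ) 1) (hb : b ∈ Set.Icc (0:ℝ) 1) :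
    a * b ∈ Set.Icc (0:ℝ) 1 :=
  ⟨mul_nonneg ha.1 hb.1, mul_le_one₀ ha.2 hb.1 hb.2⟩

theorem aux_one_sub {a : ℝ} (ha : a ∈ Set.Icc (0:ℝ) 1) : 1 - a ∈ Set.Icc (0:ℝ) 1 :=
  ⟨by linarith [ha.2], by linarith [ha.1]⟩

/-- second moment of a sum -/
theorem aux_sq {Ω : Type*} [MeasurableSpace Ω] (μ : Measure Ω) [IsProbabilityMeasure μ] {N : ℕ}
    (J p : Fin N → Ω → ℝ) (hJm : ∀ i, Measurable (J i)) (hpm : ∀ i, Measurable (p i))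
    (hJ : ∀ i ω, J i ω = 0 ∨ J i ω = 1) (hp : ∀ i ω, p i ω ∈ Set.Icc (0:ℝ) 1)
    (h : ∀ s : Finset (Fin N), ∫ ω, ∏ i ∈ s, J i ω ∂μ = ∫ ω, ∏ i ∈ s, p i ω ∂μ) :
    ∫ ω, (∑ i, J i ω) ^ 2 ∂μ
      = ∫ ω, (∑ i, p i ω) ^ 2 ∂μ + ∫ ω, ∑ i, p i ω * (1 - p i ω) ∂μ := by
  have hJ' : ∀ i ω, J i ω ∈ Set.Icc (0:ℝ) 1 := by
    intro i ω; rcases hJ i ω with h | h <;> simp [h]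
  have i1 : ∀ i j, Integrable (fun ω => J i ω * J j ω) μ := fun i j =>
    aux_bdd μ _ ((hJm i).mul (hJm j)) fun ω => aux_mul (hJ' i ω) (hJ' j ω)
  have i2 : ∀ i j, Integrable (fun ω => p i ω * p j ω) μ := fun i j =>
    aux_bdd μ _ ((hpm i).mul (hpm j)) fun ω => aux_mul (hp i ω) (hp j ω)
  have i3 : ∀ i, Integrable (fun ω => p i ω * (1 - p i ω)) μ := fun i =>
    aux_bdd μ _ ((hpm i).mul ((hpm i).const_sub 1)) fun ω => aux_mul (hp i ω) (aux_one_sub (hp i ω))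
  have key : ∀ i j, ∫ ω, J i ω * J j ω ∂μ
      = ∫ ω, p i ω * p j ω ∂μ + if i = j then ∫ ω, p i ω * (1 - p i ω) ∂μ else 0 := by
    intro i j
    split_ifs with hij
    · subst hij
      rw [← integral_add (i2 i i) (i3 i)]
      have := h {i}
      simp only [Finset.prod_singleton] at this
      calc ∫ ω, J i ω * J i ω ∂μ = ∫ ω, J i ω ∂μ := by
            congr 1; ext ω; rcases hJ i ω with h | h <;> simp [h]
        _ = _ := by rw [this]; congr 1; ext ω; ring
    · have := h {i, j}
      simp only [Finset.prod_pair hij] at this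
      rw [this, add_zero]
  simp only [sq, Finset.sum_mul_sum]
  rw [integral_finsetSum _ fun i _ => integrable_finsetSum _ fun j _ => i1 i j,
    integral_finsetSum _ fun i _ => integrable_finsetSum _ fun j _ => i2 i j,
    integral_finsetSum _ fun i _ => i3 i, ← Finset.sum_add_distrib]
  refine Finset.sum_congr rfl fun i _ => ?_
  rw [integral_finsetSum _ fun j _ => i1 i j, integral_finsetSum _ fun j _ => i2 i j]
  simp only [key, Finset.sum_add_distrib]
  simp

theorem aux_prod_pos (a : ℕ → ℝ) (ha : ∀ n, 0 ≤ a n ∧ a n < 1) (hs : Summable a) :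
    ∃ c > 0, ∀ n, c ≤ ∏ k ∈ Finset.range n, (1 - a k) := by
  have hz := hs.tendsto_atTop_zero
  obtain ⟨M, hM⟩ := (hs.hasSum.tendsto_sum_nat.eventually
    (lt_mem_nhds (show (∑' n, a n) - 1/2 < ∑' n, a n by linarith))).exists
  have hpos : ∀ n, 0 < ∏ k ∈ Finset.range n, (1 - a k) := fun n =>
    Finset.prod_pos fun k _ => by linarith [(ha k).2]
  have hle : ∀ n, ∑ k ∈ Finset.range n, a k ≤ ∑' n, a n := fun n =>
    hs.sum_le_tsum _ fun k _ => (ha k).1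
  have hanti : ∀ n m, n ≤ m →
      ∏ k ∈ Finset.range m, (1 - a k) ≤ ∏ k ∈ Finset.range n, (1 - a k) := by
    intro n m hnm
    induction m, hnm using Nat.le_induction with
    | base => exact le_rfl
    | succ m hm ih =>
      rw [Finset.prod_range_succ]
      nlinarith [hpos m, (ha m).1]
  have htail : ∀ m, M ≤ m → (∏ k ∈ Finset.range M, (1 - a k)) *
      (1 - (∑ k ∈ Finset.range m, a k - ∑ k ∈ Finset.range M, a k))
        ≤ ∏ k ∈ Finset.range m, (1 - a k) := by
    intro m hm
    induction m, hm using Nat.le_induction with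
    | base => simp
    | succ m hm ih =>
      rw [Finset.prod_range_succ, Finset.sum_range_succ]
      have := hanti M m hm
      nlinarith [hpos m, (ha m).1, hpos M]
  refine ⟨(∏ k ∈ Finset.range M, (1 - a k)) * (1/2), by have := hpos M; positivity, fun n => ?_⟩
  rcases le_total M n with h | h
  · refine le_trans ?_ (htail n h)
    have := hle n
    have h2 := hpos M
    gcongr
    linarith
  · have := hanti n M h
    linarith [hpos M]

/-- The filtration. -/
def walkFilt {Ω : Type*} [m0 : MeasurableSpace Ω] {N : ℕ}
    (Z : ℕ → Fin N → Ω → ℝ) (hZ : ∀ n i, Measurable (Z n i)) : Filtration ℕ m0 where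
  seq := walkFiltration Z
  mono' := by
    intro a b hab
    unfold walkFiltration
    refine iSup₂_le fun k hk => ?_
    refine le_iSup₂_of_le k ?_ le_rfl
    simp at hk ⊢; omega
  le' := by
    intro n
    unfold walkFiltration
    refine iSup₂_le fun k hk => iSup_le fun i => ?_
    rw [← BorelSpace.measurable_eq (α := ℝ)]
    exact (hZ k i).comap_le

theorem walkFilt_meas {Ω : Type*} [m0 : MeasurableSpace Ω] {N : ℕ}
    (Z : ℕ → Fin N → Ω → ℝ) (n : ℕ) (i : Fin N) : Measurable[walkFiltration Z n] (Z n i) := by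
  rw [measurable_iff_comap_le, BorelSpace.measurable_eq (α := ℝ)]
  unfold walkFiltration
  refine le_iSup₂_of_le n (by simp) ?_
  exact le_iSup (fun i => MeasurableSpace.comap (Z n i) (borel ℝ)) i

/-- **Theorem (convergence, ρ = 1, α > 0)**: the mean `Z_n` converges a.s. to a random
variable `Z` with values in `[0,1]`, and `P(Z ∈ {0,1}) = 1` iff `Σ r_n² = +∞`. -/
theorem stmt_0
    {Ω : Type*} [MeasurableSpace Ω] (μ : Measure Ω) [IsProbabilityMeasure μ]
    (N : ℕ) (hN : 1 ≤ N)
    (ρ α q : ℝ)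
    (hρ : ρ ∈ Set.Icc (0:ℝ) 1) (hα : α ∈ Set.Icc (0:ℝ) 1) (hq : q ∈ Set.Icc (0:ℝ) 1)
    (r : ℕ → ℝ) (hr : ∀ n, 0 ≤ r n ∧ r n < 1)
    (Z : ℕ → Fin N → Ω → ℝ) (I : ℕ → Fin N → Ω → ℝ)
    (hZmeas : ∀ n i, Measurable (Z n i))
    (hImeas : ∀ n i, Measurable (I n i))
    (hZ01 : ∀ n i ω, Z n i ω ∈ Set.Icc (0:ℝ) 1)
    (hI01 : ∀ n i ω, I n i ω = 0 ∨ I n i ω = 1)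
    -- dynamics: `Z_{n+1}(i) = (1 - r_n) Z_n(i) + r_n (ρ I_{n+1}(i) + (1-ρ) q)`
    -- (here `I n i` stands for `I_{n+1}(i)`)
    (hdyn : ∀ n i ω, Z (n + 1) i ω
      = (1 - r n) * Z n i ω + r n * (ρ * I n i ω + (1 - ρ) * q))
    -- conditional independence of `I_{n+1}(1), …, I_{n+1}(N)` given `F_n`, together with
    -- the conditional law `P(I_{n+1}(i) = 1 | F_n) = (1-α) Z_n(i) + α Z_n`, expressed
    -- (equivalently, for {0,1}-valued variables) through conditional product moments
    (hcond : ∀ n (s : Finset (Fin N)),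
      μ[(fun ω => ∏ i ∈ s, I n i ω) | walkFiltration Z n]
        =ᵐ[μ] fun ω => ∏ i ∈ s, ((1 - α) * Z n i ω + α * walkMean Z n ω))
    -- the initial configuration is permutation invariant with mean 1/2 and E[Z_0(1-Z_0)] > 0
    (hperm : ∀ σ : Equiv.Perm (Fin N),
      μ.map (fun ω (i : Fin N) => Z 0 (σ i) ω) = μ.map (fun ω (i : Fin N) => Z 0 i ω))
    (hmean0 : ∀ i, ∫ ω, Z 0 i ω ∂μ = 1 / 2)
    (hvar0 : 0 < ∫ ω, walkMean Z 0 ω * (1 - walkMean Z 0 ω) ∂μ)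
    (hρ1 : ρ = 1) (hα0 : 0 < α) :
    ∃ Zlim : Ω → ℝ,
      (∀ᵐ ω ∂μ, Tendsto (fun n => walkMean Z n ω) atTop (nhds (Zlim ω))
          ∧ Zlim ω ∈ Set.Icc (0:ℝ) 1)
      ∧ ((∀ᵐ ω ∂μ, Zlim ω = 0 ∨ Zlim ω = 1) ↔ ¬ Summable (fun n => (r n) ^ 2)) := by
  subst hρ1
  have hN0 : (0:ℝ) < N := by exact_mod_cast hN
  set M : ℕ → Ω → ℝ := walkMean Z with hMdef
  have hMS : ∀ n ω, N * M n ω = ∑ i, Z n i ω := by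
    intro n ω; simp only [hMdef, walkMean]; field_simp
  have hMF : ∀ n, Measurable[walkFiltration Z n] (M n) := by
    intro n
    have : Measurable[walkFiltration Z n] (fun ω => (∑ i, Z n i ω) / (N:ℝ)) :=
      (Finset.measurable_fun_sum _ fun i _ => walkFilt_meas Z n i).div_const _
    exact this
  have hle : ∀ n, walkFiltration Z n ≤ _ := (walkFilt Z hZmeas).le
  have hMm : ∀ n, Measurable (M n) := fun n => (hMF n).mono (hle n) le_rfl
  have hM01 : ∀ n ω, M n ω ∈ Set.Icc (0:ℝ) 1 := by
    intro n ω
    have h1 : 0 ≤ ∑ i, Z n i ω := Finset.sum_nonneg fun i _ => (hZ01 n i ω).1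
    have h2 : ∑ i, Z n i ω ≤ N := by
      calc ∑ i, Z n i ω ≤ ∑ i : Fin N, (1:ℝ) := Finset.sum_le_sum fun i _ => (hZ01 n i ω).2
        _ = N := by simp
    rw [← hMS] at h1 h2
    constructor
    · by_contra h; push Not at h; nlinarith
    · by_contra h; push Not at h; nlinarith
  have hMint : ∀ n, Integrable (M n) μ := fun n => aux_bdd μ _ (hMm n) (hM01 n)
  -- conditional probabilities
  set p : ℕ → Fin N → Ω → ℝ := fun n i ω => (1 - α) * Z n i ω + α * M n ω with hpdef
  have hpm : ∀ n i, Measurable (p n i) := fun n i =>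
    ((hZmeas n i).const_mul _).add ((hMm n).const_mul _)
  have hp01 : ∀ n i ω, p n i ω ∈ Set.Icc (0:ℝ) 1 := by
    intro n i ω
    have := hZ01 n i ω
    have := hM01 n ω
    exact (convex_Icc (0:ℝ) 1) (hZ01 n i ω) (hM01 n ω) (by linarith [hα.2]) hα.1 (by ring)
  have hpS : ∀ n ω, ∑ i, p n i ω = N * M n ω := by
    intro n ω
    simp only [hpdef, Finset.sum_add_distrib, ← Finset.mul_sum, ← hMS]
    simp; ring
  have hI01' : ∀ n i ω, I n i ω ∈ Set.Icc (0:ℝ) 1 := by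
    intro n i ω; rcases hI01 n i ω with h | h <;> simp [h]
  have hIint : ∀ n i, Integrable (I n i) μ := fun n i => aux_bdd μ _ (hImeas n i) (hI01' n i)
  have hstep : ∀ n ω, M (n+1) ω = (1 - r n) * M n ω + r n * ((∑ i, I n i ω) / N) := by
    intro n ω
    have : N * M (n+1) ω = (1 - r n) * (N * M n ω) + r n * ∑ i, I n i ω := by
      rw [hMS, hMS]
      simp only [hdyn, Finset.sum_add_distrib, ← Finset.mul_sum]
      simp
    field_simp
    linarith
  have hcond1 : ∀ n i, μ[I n i | walkFiltration Z n] =ᵐ[μ] p n i := by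
    intro n i
    have := hcond n {i}
    simpa only [Finset.prod_singleton] using this
  have hcondS : ∀ n, μ[(fun ω => ∑ i, I n i ω) | walkFiltration Z n]
      =ᵐ[μ] fun ω => N * M n ω := by
    intro n
    have h1 := condExp_finsetSum (μ := μ) (s := Finset.univ) (f := I n)
      (fun i _ => hIint n i) (walkFiltration Z n)
    have h2 : ∀ᵐ ω ∂μ, ∀ i, (μ[I n i | walkFiltration Z n]) ω = p n i ω :=
      ae_all_iff.2 fun i => hcond1 n i
    have h3 : (∑ i, I n i) = fun ω => ∑ i, I n i ω := by ext ω; simp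
    rw [h3] at h1
    filter_upwards [h1, h2] with ω h1 h2
    rw [h1, Finset.sum_apply, ← hpS]
    exact Finset.sum_congr rfl fun i _ => h2 i
  have hSint : ∀ n, Integrable (fun ω => ∑ i, I n i ω) μ := fun n =>
    integrable_finsetSum _ fun i _ => hIint n i
  have hMZ : ∀ n, Integrable (fun ω => M n ω * ∑ i, I n i ω) μ := by
    intro n
    simp only [Finset.mul_sum]
    exact integrable_finsetSum _ fun i _ => aux_bdd μ _ ((hMm n).mul (hImeas n i))
      fun ω => aux_mul (hM01 n ω) (hI01' n i ω)
  have hSm : ∀ n, Measurable (fun ω => ∑ i, I n i ω) := fun n =>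
    Finset.measurable_fun_sum _ fun i _ => hImeas n i
  have hSSint : ∀ n, Integrable (fun ω => (∑ i, I n i ω)^2) μ := by
    intro n
    simp only [sq, Finset.sum_mul_sum]
    exact integrable_finsetSum _ fun i _ => integrable_finsetSum _ fun j _ =>
      aux_bdd μ _ ((hImeas n i).mul (hImeas n j)) fun ω => aux_mul (hI01' n i ω) (hI01' n j ω)
  have hMMint : ∀ n, Integrable (fun ω => M n ω ^ 2) μ := by
    intro n
    simp only [sq]
    exact aux_bdd μ _ ((hMm n).mul (hMm n)) fun ω => aux_mul (hM01 n ω) (hM01 n ω)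
  have hVint : ∀ n, Integrable (fun ω => ∑ i, p n i ω * (1 - p n i ω)) μ := fun n =>
    integrable_finsetSum _ fun i _ => aux_bdd μ _ ((hpm n i).mul ((hpm n i).const_sub 1))
      fun ω => aux_mul (hp01 n i ω) (aux_one_sub (hp01 n i ω))
  have hUint : ∀ n, Integrable (fun ω => M n ω * (1 - M n ω)) μ := fun n =>
    aux_bdd μ _ ((hMm n).mul ((hMm n).const_sub 1))
      fun ω => aux_mul (hM01 n ω) (aux_one_sub (hM01 n ω))
  -- martingale
  have hmart : Martingale M (walkFilt Z hZmeas) μ := by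
    refine martingale_nat (fun n => (hMF n).stronglyMeasurable) hMint fun n => ?_
    have e : M (n+1) = (1 - r n) • M n + (r n / N) • (fun ω => ∑ i, I n i ω) := by
      ext ω; rw [hstep]; simp; ring
    rw [e]
    have h1 := condExp_add (μ := μ) ((hMint n).smul (1 - r n)) ((hSint n).smul (r n / N))
      (walkFilt Z hZmeas n)
    have h2 := condExp_smul (μ := μ) (1 - r n) (M n) (walkFilt Z hZmeas n)
    have h3 := condExp_smul (μ := μ) (r n / N) (fun ω => ∑ i, I n i ω) (walkFilt Z hZmeas n)
    have h4 : μ[M n | walkFilt Z hZmeas n] = M n :=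
      condExp_of_stronglyMeasurable (hle n) (hMF n).stronglyMeasurable (hMint n)
    have h5 : μ[(fun ω => ∑ i, I n i ω) | walkFilt Z hZmeas n] =ᵐ[μ] fun ω => N * M n ω :=
      hcondS n
    filter_upwards [h1, h2, h3, h5] with ω h1 h2 h3 h5
    rw [h1, Pi.add_apply, h2, h3, Pi.smul_apply, Pi.smul_apply, h4, h5]
    simp only [smul_eq_mul]
    field_simp
    ring
  have hconv : ∀ᵐ ω ∂μ, ∃ c, Tendsto (fun n => M n ω) atTop (nhds c) := by
    refine hmart.submartingale.exists_ae_tendsto_of_bdd (R := 1) fun n => ?_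
    refine (eLpNorm_le_of_ae_bound (C := 1) (Eventually.of_forall fun ω => ?_)).trans ?_
    · rw [Real.norm_eq_abs, abs_of_nonneg (hM01 n ω).1]; exact (hM01 n ω).2
    · simp
  -- recursion
  set u : ℕ → ℝ := fun n => ∫ ω, M n ω * (1 - M n ω) ∂μ with hu
  set v : ℕ → ℝ := fun n => ∫ ω, ∑ i, p n i ω * (1 - p n i ω) ∂μ with hv
  have hrec : ∀ n, u (n+1) = u n - (r n)^2 / N^2 * v n := by
    intro n
    have e1 : ∫ ω, ∑ i, I n i ω ∂μ = ∫ ω, N * M n ω ∂μ := aux_int μ (hle n) _ _ (hcondS n)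
    have e2 : ∫ ω, M n ω * ∑ i, I n i ω ∂μ = ∫ ω, M n ω * (N * M n ω) ∂μ :=
      aux_int_mul μ (hle n) _ _ _ (hMF n).stronglyMeasurable (hSint n) (hMZ n) (hcondS n)
    have e3 := aux_sq μ (I n) (p n) (hImeas n) (hpm n) (hI01 n) (hp01 n)
      (fun s => aux_int μ (hle n) _ _ (hcond n s))
    simp only [hpS] at e3
    have e2' : ∫ ω, M n ω * (N * M n ω) ∂μ = N * ∫ ω, M n ω ^ 2 ∂μ := by
      rw [← integral_const_mul]; congr 1; ext ω; ring
    have e3' : ∫ ω, (N * M n ω)^2 ∂μ = N^2 * ∫ ω, M n ω ^ 2 ∂μ := by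
      rw [← integral_const_mul]; congr 1; ext ω; ring
    rw [integral_const_mul] at e1
    have a1 : u n = ∫ ω, M n ω ∂μ - ∫ ω, M n ω ^ 2 ∂μ := by
      rw [← integral_sub (hMint n) (hMMint n)]; simp only [hu]; congr 1; ext ω; ring
    have a2 : u (n+1) = (1 - r n) * ∫ ω, M n ω ∂μ + r n / N * ∫ ω, ∑ i, I n i ω ∂μ
        - ((1 - r n)^2 * ∫ ω, M n ω ^ 2 ∂μ
          + 2 * (1 - r n) * r n / N * ∫ ω, M n ω * ∑ i, I n i ω ∂μ
          + (r n)^2 / N^2 * ∫ ω, (∑ i, I n i ω)^2 ∂μ) := by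
      simp only [← integral_const_mul]
      have j1 : Integrable (fun ω => (1 - r n) * M n ω + r n / N * ∑ i, I n i ω) μ :=
        ((hMint n).const_mul _).add ((hSint n).const_mul _)
      have j2 : Integrable (fun ω => (1 - r n)^2 * M n ω ^ 2
          + 2 * (1 - r n) * r n / N * (M n ω * ∑ i, I n i ω)) μ :=
        ((hMMint n).const_mul _).add ((hMZ n).const_mul _)
      have j3 : Integrable (fun ω => (1 - r n)^2 * M n ω ^ 2
          + 2 * (1 - r n) * r n / N * (M n ω * ∑ i, I n i ω)
          + (r n)^2 / N^2 * (∑ i, I n i ω)^2) μ :=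
        j2.add ((hSSint n).const_mul _)
      rw [← integral_add ((hMint n).const_mul _) ((hSint n).const_mul _),
        ← integral_add ((hMMint n).const_mul _) ((hMZ n).const_mul _),
        ← integral_add j2 ((hSSint n).const_mul _), ← integral_sub j1 j3]
      simp only [hu]; congr 1; ext ω
      rw [hstep]
      field_simp
      ring
    rw [a2, a1, e1, e2, e2', e3, e3']
    simp only [hv]
    field_simp
    ring
  have hvlow : ∀ n, N * α^2 * u n ≤ v n := by
    intro n
    simp only [hu, hv]
    rw [← integral_const_mul]
    refine integral_mono ((hUint n).const_mul _) (hVint n) fun ω => ?_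
    have : ∀ i, α^2 * (M n ω * (1 - M n ω)) ≤ p n i ω * (1 - p n i ω) := by
      intro i
      have hz := hZ01 n i ω
      have hm := hM01 n ω
      have h1 : α * M n ω ≤ p n i ω := by
        simp only [hpdef]; nlinarith [hz.1, hα.2]
      have h2 : α * (1 - M n ω) ≤ 1 - p n i ω := by
        simp only [hpdef]; nlinarith [hz.2, hα.2]
      calc α^2 * (M n ω * (1 - M n ω)) = (α * M n ω) * (α * (1 - M n ω)) := by ring
        _ ≤ _ := mul_le_mul h1 h2 (mul_nonneg hα.1 (by linarith [hm.2])) (hp01 n i ω).1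
    calc N * α^2 * (M n ω * (1 - M n ω)) = ∑ i : Fin N, α^2 * (M n ω * (1 - M n ω)) := by
          simp; ring
      _ ≤ _ := Finset.sum_le_sum fun i _ => this i
  have hvup : ∀ n, v n ≤ N * u n := by
    intro n
    simp only [hu, hv]
    rw [← integral_const_mul]
    refine integral_mono (hVint n) ((hUint n).const_mul _) fun ω => ?_
    have hsq : 0 ≤ ∑ i, (p n i ω - M n ω)^2 := Finset.sum_nonneg fun i _ => sq_nonneg _
    have e : ∑ i, p n i ω * (1 - p n i ω) + ∑ i, (p n i ω - M n ω)^2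
        = N * (M n ω * (1 - M n ω)) := by
      rw [← Finset.sum_add_distrib]
      calc _ = ∑ i, ((1 - 2 * M n ω) * p n i ω + M n ω ^ 2) := by
            refine Finset.sum_congr rfl fun i _ => by ring
        _ = _ := by
            rw [Finset.sum_add_distrib, ← Finset.mul_sum, hpS]; simp; ring
    show _ ≤ (N:ℝ) * (M n ω * (1 - M n ω))
    linarith
  have hu0 : ∀ n, 0 ≤ u n := fun n => integral_nonneg fun ω =>
    (aux_mul (hM01 n ω) (aux_one_sub (hM01 n ω))).1
  choose! L hL using fun ω (h : ∃ c, Tendsto (fun n => M n ω) atTop (nhds c)) => h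
  have hLt : ∀ᵐ ω ∂μ, Tendsto (fun n => M n ω) atTop (nhds (L ω)) := by
    filter_upwards [hconv] with ω h using hL ω h
  have hL01 : ∀ᵐ ω ∂μ, L ω ∈ Set.Icc (0:ℝ) 1 := by
    filter_upwards [hLt] with ω h
    exact isClosed_Icc.mem_of_tendsto h (Eventually.of_forall fun n => hM01 n ω)
  have hulim : Tendsto u atTop (nhds (∫ ω, L ω * (1 - L ω) ∂μ)) := by
    refine tendsto_integral_of_dominated_convergence (fun _ => 1)
      (fun n => (hUint n).aestronglyMeasurable) (integrable_const _) (fun n => ?_) ?_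
    · refine Eventually.of_forall fun ω => ?_
      have := aux_mul (hM01 n ω) (aux_one_sub (hM01 n ω))
      rw [Real.norm_eq_abs, abs_of_nonneg this.1]; exact this.2
    · filter_upwards [hLt] with ω h
      exact h.mul (h.const_sub 1)
  have hLm : AEStronglyMeasurable L μ :=
    aestronglyMeasurable_of_tendsto_ae atTop (fun n => (hMint n).aestronglyMeasurable) hLt
  have hLLint : Integrable (fun ω => L ω * (1 - L ω)) μ := by
    refine Integrable.of_bound (hLm.mul (aestronglyMeasurable_const.sub hLm)) 1 ?_
    filter_upwards [hL01] with ω h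
    have := aux_mul h (aux_one_sub h)
    rw [Real.norm_eq_abs, abs_of_nonneg this.1]; exact this.2
  have hiff : (∀ᵐ ω ∂μ, L ω = 0 ∨ L ω = 1) ↔ ∫ ω, L ω * (1 - L ω) ∂μ = 0 := by
    rw [integral_eq_zero_iff_of_nonneg_ae ?_ hLLint]
    · refine eventually_congr (Eventually.of_forall fun ω => ?_)
      simp only [Pi.zero_apply, mul_eq_zero, sub_eq_zero, eq_comm (a := (1:ℝ))]
    · filter_upwards [hL01] with ω h using (aux_mul h (aux_one_sub h)).1
  have hv0 : ∀ n, 0 ≤ v n := fun n =>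
    le_trans (by have := hu0 n; positivity) (hvlow n)
  refine ⟨L, hLt.and hL01, ?_⟩
  rw [hiff]
  constructor
  · intro h0 hs
    have hN1 : (1:ℝ) ≤ N := by exact_mod_cast hN
    obtain ⟨c, hc, hcl⟩ := aux_prod_pos (fun n => (r n)^2) (fun n => ⟨sq_nonneg _, by
      nlinarith [(hr n).1, (hr n).2]⟩) hs
    have hlow : ∀ n, u 0 * ∏ k ∈ Finset.range n, (1 - (r k)^2) ≤ u n := by
      intro n
      induction n with
      | zero => simp
      | succ n ih =>
        rw [Finset.prod_range_succ, hrec, ← mul_assoc]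
        have h1 : (r n)^2 < 1 := by nlinarith [(hr n).1, (hr n).2]
        have h2 : (r n)^2 / N^2 * v n ≤ (r n)^2 * u n := by
          rw [div_mul_eq_mul_div, div_le_iff₀ (by positivity), mul_assoc]
          refine mul_le_mul_of_nonneg_left ?_ (sq_nonneg _)
          refine (hvup n).trans ?_
          nlinarith [hu0 n, mul_nonneg (hu0 n) (mul_nonneg hN0.le (sub_nonneg.2 hN1))]
        have h3 := mul_le_mul_of_nonneg_right ih (by linarith : 0 ≤ 1 - (r n)^2)
        linarith
    have hlim := ge_of_tendsto' hulim (b := u 0 * c) fun n =>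
      (mul_le_mul_of_nonneg_left (hcl n) (hu0 0)).trans (hlow n)
    have : 0 < u 0 * c := mul_pos hvar0 hc
    linarith
  · intro hs
    by_contra hne
    set ℓ := ∫ ω, L ω * (1 - L ω) ∂μ with hℓ
    have hanti : Antitone u := antitone_nat_of_succ_le fun n => by
      rw [hrec]
      have := hv0 n
      have : 0 ≤ (r n)^2 / N^2 * v n := by positivity
      linarith
    have hle' : ∀ n, ℓ ≤ u n := fun n => hanti.le_of_tendsto hulim n
    have hℓ0 : 0 < ℓ := lt_of_le_of_ne (ge_of_tendsto' hulim hu0) (Ne.symm hne)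
    have hsum : ∀ n, (α^2 / N * ℓ) * ∑ k ∈ Finset.range n, (r k)^2 ≤ u 0 - u n := by
      intro n
      induction n with
      | zero => simp
      | succ n ih =>
        rw [Finset.sum_range_succ, hrec, mul_add]
        have h1 : N * α^2 * ℓ ≤ v n :=
          le_trans (mul_le_mul_of_nonneg_left (hle' n) (by positivity)) (hvlow n)
        have h2 : (r n)^2 / N^2 * (N * α^2 * ℓ) ≤ (r n)^2 / N^2 * v n :=
          mul_le_mul_of_nonneg_left h1 (by positivity)
        have h3 : (r n)^2 / N^2 * (N * α^2 * ℓ) = α^2 / N * ℓ * (r n)^2 := by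
          field_simp
        linarith
    apply hs
    have hc : 0 < α^2 / N * ℓ := by positivity
    refine summable_of_sum_range_le (c := u 0 / (α^2 / N * ℓ)) (fun n => sq_nonneg _) fun n => ?_
    rw [le_div_iff₀ hc]
    linarith [hsum n, hu0 n]
end
end

section
/- Suppose ρ < 1, Σ_n r_n = +∞ and Σ_n r_n² < +∞. Then Z_n → q almost surely. -/
open MeasureTheory Filter Real

noncomputable section

theorem aux_seq (e a b : ℕ → ℝ) (l : ℝ) (he0 : ∀ n, 0 ≤ e n) (ha : ∀ n, 0 ≤ a n)
    (hb0 : ∀ n, 0 ≤ b n)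
    (hrec : ∀ n, e (n+1) ≤ (1 - a n) * e n + b n) (hb : Summable b) (hna : ¬ Summable a)
    (hl : Tendsto e atTop (nhds l)) : l = 0 := by
  have hl0 : 0 ≤ l := ge_of_tendsto' hl he0
  by_contra hne
  have hlpos : 0 < l := lt_of_le_of_ne hl0 (Ne.symm hne)
  apply hna
  have hsum : Summable (fun n => a n * e n) := by
    apply summable_of_sum_range_le (c := e 0 + ∑' n, b n) (fun n => mul_nonneg (ha n) (he0 n))
    intro n
    have h1 : ∀ n, ∑ i ∈ Finset.range n, a i * e i + e n ≤ e 0 + ∑ i ∈ Finset.range n, b i := by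
      intro n
      induction n with
      | zero => simp
      | succ k ih =>
        rw [Finset.sum_range_succ, Finset.sum_range_succ]
        linarith [hrec k]
    have h2 := hb.sum_le_tsum (Finset.range n) (fun i _ => hb0 i)
    linarith [h1 n, he0 n]
  have hev : ∀ᶠ n in atTop, l / 2 < e n := hl.eventually (lt_mem_nhds (by linarith))
  have hsum2 : Summable (fun n => (2 / l) * (a n * e n)) := hsum.mul_left _
  refine summable_of_isBigO_nat hsum2 ?_
  refine Asymptotics.IsBigO.of_bound 1 ?_
  filter_upwards [hev] with n hn
  have h3 : 0 ≤ (2 / l) * (a n * e n) :=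
    mul_nonneg (by positivity) (mul_nonneg (ha n) (he0 n))
  rw [Real.norm_of_nonneg (ha n), Real.norm_of_nonneg h3, one_mul]
  have : (2 / l) * (a n * e n) = a n * (e n * 2 / l) := by ring
  rw [this]
  refine le_mul_of_one_le_right (ha n) ?_
  rw [le_div_iff₀ hlpos]; linarith

theorem aux_prob {Ω : Type*} [m0 : MeasurableSpace Ω] (μ : Measure Ω) [IsProbabilityMeasure μ]
    (F : Filtration ℕ m0) (X ξ : ℕ → Ω → ℝ) (a r : ℕ → ℝ)
    (hX : ∀ n, StronglyMeasurable[F n] (X n))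
    (hξm : ∀ n, Measurable (ξ n))
    (hXb : ∀ n ω, |X n ω| ≤ 1) (hξb : ∀ n ω, |ξ n ω| ≤ r n)
    (ha : ∀ n, 0 ≤ a n) (ha1 : ∀ n, a n ≤ 1)
    (hdyn : ∀ n ω, X (n+1) ω = (1 - a n) * X n ω + ξ n ω)
    (hc : ∀ n, μ[ξ n | F n] =ᵐ[μ] 0)
    (hna : ¬ Summable a) (hrsq : Summable (fun n => (r n) ^ 2)) :
    ∀ᵐ ω ∂μ, Tendsto (fun n => X n ω) atTop (nhds 0) := by
  have hXm : ∀ n, Measurable (X n) := fun n => ((hX n).mono (F.le n)).measurable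
  have bint : ∀ (f : Ω → ℝ) (C : ℝ), Measurable f → (∀ ω, |f ω| ≤ C) → Integrable f μ := by
    intro f C hf hC
    exact Integrable.of_bound hf.aestronglyMeasurable C (ae_of_all _ hC)
  have hξi : ∀ n, Integrable (ξ n) μ := fun n => bint _ _ (hξm n) (hξb n)
  have hsqb : ∀ n ω, X n ω ^ 2 ≤ 1 := fun n ω => (sq_le_one_iff_abs_le_one _).2 (hXb n ω)
  have hsqi : ∀ n, Integrable (fun ω => X n ω ^ 2) μ := fun n =>
    bint _ 1 ((hXm n).pow_const 2) (fun ω => by rw [abs_of_nonneg (sq_nonneg _)]; exact hsqb n ω)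
  have hXξi : ∀ n, Integrable (X n * ξ n) μ := fun n =>
    bint _ (r n) ((hXm n).mul (hξm n)) (fun ω => by
      simp only [Pi.mul_apply, abs_mul]
      exact (mul_le_of_le_one_left (abs_nonneg _) (hXb n ω)).trans (hξb n ω))
  have hcross : ∀ n, μ[X n * ξ n | F n] =ᵐ[μ] 0 := by
    intro n
    have h1 := condExp_mul_of_stronglyMeasurable_left (hX n) (hXξi n) (hξi n)
    filter_upwards [h1, hc n] with ω h1 h2
    rw [h1]; simp [h2]
  have hcross0 : ∀ n, ∫ ω, X n ω * ξ n ω ∂μ = 0 := by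
    intro n
    have h1 := integral_condExp (μ := μ) (f := X n * ξ n) (F.le n)
    rw [integral_congr_ae (hcross n)] at h1
    simpa using h1.symm
  have hstep : ∀ n ω, X (n+1) ω ^ 2 ≤
      (1 - a n) * X n ω ^ 2 + r n ^ 2 + (2 * (1 - a n)) * (X n ω * ξ n ω) := by
    intro n ω
    rw [hdyn]
    have h1 : ξ n ω ^ 2 ≤ r n ^ 2 := sq_le_sq' (by linarith [(abs_le.1 (hξb n ω)).1])
      (abs_le.1 (hξb n ω)).2
    have h2 : (1 - a n)^2 * X n ω ^2 ≤ (1 - a n) * X n ω ^ 2 := by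
      apply mul_le_mul_of_nonneg_right _ (sq_nonneg _)
      nlinarith [ha n, ha1 n]
    nlinarith
  set S : ℕ → ℝ := fun n => ∑ k ∈ Finset.range n, r k ^ 2 with hS
  have hSle : ∀ n, S n ≤ ∑' k, r k ^ 2 := fun n => hrsq.sum_le_tsum _ (fun i _ => sq_nonneg _)
  have hS0 : ∀ n, 0 ≤ S n := fun n => Finset.sum_nonneg (fun i _ => sq_nonneg _)
  have hsub : Submartingale (fun n ω => S n - X n ω ^ 2) F μ := by
    apply submartingale_nat
    · intro n
      exact (stronglyMeasurable_const.sub ((hX n).pow 2))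
    · intro n
      exact (integrable_const _).sub (hsqi n)
    · intro n
      have hm : StronglyMeasurable[F n] (fun ω => S n - X n ω ^ 2) :=
        stronglyMeasurable_const.sub ((hX n).pow 2)
      have hi : Integrable (fun ω => S n - X n ω ^ 2) μ := (integrable_const _).sub (hsqi n)
      have h1 : μ[(fun ω => S n - X n ω ^ 2) - (2 * (1 - a n)) • (X n * ξ n) | F n] ≤ᵐ[μ]
          μ[(fun ω => S (n+1) - X (n+1) ω ^ 2) | F n] := by
        apply condExp_mono (hi.sub ((hXξi n).smul _)) ((integrable_const _).sub (hsqi (n+1)))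
        refine ae_of_all _ (fun ω => ?_)
        have := hstep n ω
        have h3 : S (n+1) = S n + r n ^ 2 := Finset.sum_range_succ _ _
        have h4 := mul_nonneg (ha n) (sq_nonneg (X n ω))
        simp only [Pi.sub_apply, Pi.smul_apply, Pi.mul_apply, smul_eq_mul]
        change _ ≤ S (n+1) - _
        rw [h3]
        linarith
      have h2 := condExp_sub hi ((hXξi n).smul (2 * (1 - a n))) (F n)
      have h3 := condExp_smul (μ := μ) (2 * (1 - a n)) (X n * ξ n) (F n)
      rw [condExp_of_stronglyMeasurable (F.le n) hm hi] at h2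
      filter_upwards [h1, h2, h3, hcross n] with ω h1 h2 h3 h4
      rw [h2, Pi.sub_apply, h3, Pi.smul_apply, h4] at h1
      simpa using h1
  have hbdd : ∀ n, eLpNorm (fun ω => S n - X n ω ^ 2) 1 μ ≤
      ((Real.toNNReal (∑' k, r k ^ 2 + 1) : NNReal) : ENNReal) := by
    intro n
    refine (eLpNorm_le_of_ae_bound (C := ∑' k, r k ^ 2 + 1) (ae_of_all _ fun ω => ?_)).trans ?_
    · rw [Real.norm_eq_abs, abs_le]
      constructor <;> linarith [hSle n, hS0 n, hsqb n ω, sq_nonneg (X n ω)]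
    · simp [ENNReal.ofReal]
  have hconv := hsub.exists_ae_tendsto_of_bdd hbdd
  have hSt : Tendsto S atTop (nhds (∑' k, r k ^ 2)) := hrsq.hasSum.tendsto_sum_nat
  have hconv2 : ∀ᵐ ω ∂μ, ∃ c, Tendsto (fun n => X n ω ^ 2) atTop (nhds c) := by
    filter_upwards [hconv] with ω ⟨c, hc⟩
    refine ⟨_, (hSt.sub hc).congr fun n => ?_⟩
    ring
  classical
  set L : Ω → ℝ := fun ω => if h : ∃ c, Tendsto (fun n => X n ω ^ 2) atTop (nhds c)
    then h.choose else 0 with hL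
  have hLt : ∀ᵐ ω ∂μ, Tendsto (fun n => X n ω ^ 2) atTop (nhds (L ω)) := by
    filter_upwards [hconv2] with ω h
    simp only [hL, dif_pos h]
    exact h.choose_spec
  have hLm : AEStronglyMeasurable L μ :=
    aestronglyMeasurable_of_tendsto_ae atTop (fun n => (hsqi n).aestronglyMeasurable) hLt
  have hL0 : ∀ᵐ ω ∂μ, 0 ≤ L ω := by
    filter_upwards [hLt] with ω h
    exact ge_of_tendsto' h (fun n => sq_nonneg _)
  have hLi : Integrable L μ := by
    refine Integrable.of_bound hLm 1 ?_
    filter_upwards [hLt, hL0] with ω h h0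
    rw [Real.norm_of_nonneg h0]
    exact le_of_tendsto' h (fun n => hsqb n ω)
  have hint : Tendsto (fun n => ∫ ω, X n ω ^ 2 ∂μ) atTop (nhds (∫ ω, L ω ∂μ)) := by
    refine tendsto_integral_of_dominated_convergence (fun _ => 1)
      (fun n => (hsqi n).aestronglyMeasurable) (integrable_const _) ?_ hLt
    intro n
    refine ae_of_all _ fun ω => ?_
    rw [Real.norm_of_nonneg (sq_nonneg _)]; exact hsqb n ω
  have hz : ∫ ω, L ω ∂μ = 0 := by
    refine aux_seq _ a (fun n => r n ^ 2) _ (fun n => integral_nonneg fun ω => sq_nonneg _) ha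
      (fun n => sq_nonneg _) ?_ hrsq hna hint
    intro n
    have hi1 : Integrable (fun ω => (1 - a n) * X n ω ^ 2) μ := (hsqi n).const_mul _
    have hi2 : Integrable (fun ω => (1 - a n) * X n ω ^ 2 + r n ^ 2) μ :=
      hi1.add (integrable_const _)
    have hi3 : Integrable (fun ω => (2 * (1 - a n)) * (X n ω * ξ n ω)) μ := (hXξi n).const_mul _
    have h1 := integral_mono (hsqi (n+1)) (hi2.add hi3) (fun ω => hstep n ω)
    have h2 := integral_add hi2 hi3
    have h3 := integral_add hi1 (integrable_const (μ := μ) (r n ^ 2))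
    rw [integral_const_mul] at h3
    rw [integral_const_mul, hcross0, h3] at h2
    simp only [Pi.add_apply] at h1
    rw [h2] at h1
    simpa using h1
  have hLz := (integral_eq_zero_iff_of_nonneg_ae hL0 hLi).1 hz
  filter_upwards [hLt, hLz] with ω h h0
  rw [h0] at h
  have h5 := (Real.continuous_sqrt.tendsto _).comp h
  simp only [Pi.zero_apply, Real.sqrt_zero] at h5
  rw [tendsto_zero_iff_abs_tendsto_zero]
  refine h5.congr fun n => ?_
  simp [Real.sqrt_sq_eq_abs]

/-- **Theorem (convergence, ρ < 1)**: if `Σ r_n = +∞` and `Σ r_n² < +∞`,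
then `Z_n → q` almost surely. -/
theorem stmt_2
    {Ω : Type*} [MeasurableSpace Ω] (μ : Measure Ω) [IsProbabilityMeasure μ]
    (N : ℕ) (hN : 1 ≤ N)
    (ρ α q : ℝ)
    (hρ : ρ ∈ Set.Icc (0:ℝ) 1) (hα : α ∈ Set.Icc (0:ℝ) 1) (hq : q ∈ Set.Icc (0:ℝ) 1)
    (r : ℕ → ℝ) (hr : ∀ n, 0 ≤ r n ∧ r n < 1)
    (Z : ℕ → Fin N → Ω → ℝ) (I : ℕ → Fin N → Ω → ℝ)
    (hZmeas : ∀ n i, Measurable (Z n i))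
    (hImeas : ∀ n i, Measurable (I n i))
    (hZ01 : ∀ n i ω, Z n i ω ∈ Set.Icc (0:ℝ) 1)
    (hI01 : ∀ n i ω, I n i ω = 0 ∨ I n i ω = 1)
    -- dynamics: `Z_{n+1}(i) = (1 - r_n) Z_n(i) + r_n (ρ I_{n+1}(i) + (1-ρ) q)`
    -- (here `I n i` stands for `I_{n+1}(i)`)
    (hdyn : ∀ n i ω, Z (n + 1) i ω
      = (1 - r n) * Z n i ω + r n * (ρ * I n i ω + (1 - ρ) * q))
    -- conditional independence of `I_{n+1}(1), …, I_{n+1}(N)` given `F_n`, together with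
    -- the conditional law `P(I_{n+1}(i) = 1 | F_n) = (1-α) Z_n(i) + α Z_n`, expressed
    -- (equivalently, for {0,1}-valued variables) through conditional product moments
    (hcond : ∀ n (s : Finset (Fin N)),
      μ[(fun ω => ∏ i ∈ s, I n i ω) | walkFiltration Z n]
        =ᵐ[μ] fun ω => ∏ i ∈ s, ((1 - α) * Z n i ω + α * walkMean Z n ω))
    -- the initial configuration is permutation invariant with mean 1/2 and E[Z_0(1-Z_0)] > 0
    (hperm : ∀ σ : Equiv.Perm (Fin N),
      μ.map (fun ω (i : Fin N) => Z 0 (σ i) ω) = μ.map (fun ω (i : Fin N) => Z 0 i ω))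
    (hmean0 : ∀ i, ∫ ω, Z 0 i ω ∂μ = 1 / 2)
    (hvar0 : 0 < ∫ ω, walkMean Z 0 ω * (1 - walkMean Z 0 ω) ∂μ)
    (hρ1 : ρ < 1) (hrdiv : ¬ Summable r) (hrsq : Summable (fun n => (r n) ^ 2)) :
    ∀ᵐ ω ∂μ, Tendsto (fun n => walkMean Z n ω) atTop (nhds q) := by
  have hN0 : (0:ℝ) < N := by exact_mod_cast hN
  have hF : ∀ n, walkFiltration Z n ≤ (inferInstance : MeasurableSpace Ω) := by
    intro n
    refine iSup₂_le fun k _ => iSup_le fun i => ?_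
    have h := (hZmeas k i).comap_le
    rwa [BorelSpace.measurable_eq (α := ℝ)] at h
  let F : Filtration ℕ (inferInstance : MeasurableSpace Ω) :=
    { seq := walkFiltration Z
      mono' := by
        intro n m hnm
        refine iSup₂_le fun k hk => ?_
        have hk' : k ∈ Finset.range (m + 1) := by
          rw [Finset.mem_range] at hk ⊢; omega
        exact le_iSup₂_of_le (f := fun k (_ : k ∈ Finset.range (m + 1)) =>
          ⨆ i : Fin N, MeasurableSpace.comap (Z k i) (borel ℝ)) k hk' le_rfl
      le' := hF }
  have hZF : ∀ n i, Measurable[F n] (Z n i) := by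
    intro n i
    rw [measurable_iff_comap_le, BorelSpace.measurable_eq (α := ℝ)]
    have hn : n ∈ Finset.range (n + 1) := by simp
    exact le_iSup₂_of_le (f := fun k (_ : k ∈ Finset.range (n + 1)) =>
          ⨆ i : Fin N, MeasurableSpace.comap (Z k i) (borel ℝ)) n hn
          (le_iSup (fun i => MeasurableSpace.comap (Z n i) (borel ℝ)) i)
  have hWF : ∀ n, Measurable[F n] (walkMean Z n) := by
    intro n
    unfold walkMean
    exact (Finset.measurable_fun_sum _ (fun i _ => hZF n i)).div_const _
  have hmean01 : ∀ (f : Fin N → ℝ), (∀ i, f i ∈ Set.Icc (0:ℝ) 1) →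
      (∑ i, f i) / N ∈ Set.Icc (0:ℝ) 1 := by
    intro f hf
    refine ⟨div_nonneg (Finset.sum_nonneg fun i _ => (hf i).1) hN0.le, ?_⟩
    rw [div_le_one hN0]
    calc ∑ i, f i ≤ ∑ i : Fin N, (1:ℝ) := Finset.sum_le_sum fun i _ => (hf i).2
      _ = N := by simp
  have hW01 : ∀ n ω, walkMean Z n ω ∈ Set.Icc (0:ℝ) 1 := fun n ω =>
    hmean01 _ (fun i => hZ01 n i ω)
  have hII : ∀ n i ω, I n i ω ∈ Set.Icc (0:ℝ) 1 := by
    intro n i ω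
    rcases hI01 n i ω with h | h <;> rw [h] <;> simp
  have hJ01 : ∀ n ω, walkMean I n ω ∈ Set.Icc (0:ℝ) 1 := fun n ω =>
    hmean01 _ (fun i => hII n i ω)
  have hJm : ∀ n, Measurable (walkMean I n) := by
    intro n
    unfold walkMean
    exact (Finset.measurable_fun_sum _ (fun i _ => hImeas n i)).div_const _
  have hWm : ∀ n, Measurable (walkMean Z n) := fun n => (hWF n).mono (F.le n) le_rfl
  have hIi : ∀ n i, Integrable (I n i) μ := fun n i =>
    Integrable.of_bound (hImeas n i).aestronglyMeasurable 1 (ae_of_all _ fun ω => by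
      rw [Real.norm_of_nonneg (hII n i ω).1]; exact (hII n i ω).2)
  have hJi : ∀ n, Integrable (walkMean I n) μ := fun n =>
    Integrable.of_bound (hJm n).aestronglyMeasurable 1 (ae_of_all _ fun ω => by
      rw [Real.norm_of_nonneg (hJ01 n ω).1]; exact (hJ01 n ω).2)
  have hWi : ∀ n, Integrable (walkMean Z n) μ := fun n =>
    Integrable.of_bound (hWm n).aestronglyMeasurable 1 (ae_of_all _ fun ω => by
      rw [Real.norm_of_nonneg (hW01 n ω).1]; exact (hW01 n ω).2)
  have hJc : ∀ n, μ[walkMean I n | F n] =ᵐ[μ] walkMean Z n := by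
    intro n
    have h0 : walkMean I n = (N:ℝ)⁻¹ • ∑ i : Fin N, I n i := by
      funext ω
      simp [walkMean, Finset.sum_apply, div_eq_inv_mul]
    have h1 := condExp_smul (μ := μ) ((N:ℝ)⁻¹) (∑ i : Fin N, I n i) (F n)
    have h2 := condExp_finsetSum (μ := μ) (s := Finset.univ) (f := fun i : Fin N => I n i)
      (fun i _ => hIi n i) (F n)
    have h3 : ∀ᵐ ω ∂μ, ∀ i : Fin N, (μ[I n i | F n]) ω
        = (1 - α) * Z n i ω + α * walkMean Z n ω := by
      rw [ae_all_iff]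
      intro i
      have := hcond n {i}
      simp only [Finset.prod_singleton] at this
      exact this
    rw [h0]
    filter_upwards [h1, h2, h3] with ω h1 h2 h3
    rw [h1, Pi.smul_apply, h2, Finset.sum_apply, Finset.sum_congr rfl (fun i _ => h3 i),
      Finset.sum_add_distrib, ← Finset.mul_sum]
    simp only [walkMean, smul_eq_mul, Finset.sum_const, Finset.card_univ, Fintype.card_fin,
      nsmul_eq_mul]
    field_simp
    ring
  have key := aux_prob μ F (fun n ω => walkMean Z n ω - q)
    (fun n ω => (r n * ρ) * (walkMean I n ω - walkMean Z n ω))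
    (fun n => r n * (1 - ρ)) r
    (fun n => ((hWF n).sub_const q).stronglyMeasurable)
    (fun n => ((hJm n).sub (hWm n)).const_mul _)
    (fun n ω => by
      have := hW01 n ω
      rw [abs_le]; constructor <;> linarith [this.1, this.2, hq.1, hq.2])
    (fun n ω => by
      have h1 := hW01 n ω
      have h2 := hJ01 n ω
      have h3 : |walkMean I n ω - walkMean Z n ω| ≤ 1 := by
        rw [abs_le]; constructor <;> linarith [h1.1, h1.2, h2.1, h2.2]
      rw [abs_mul, abs_mul, abs_of_nonneg (hr n).1, abs_of_nonneg hρ.1, mul_assoc]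
      exact mul_le_of_le_one_right (hr n).1 (mul_le_one₀ hρ.2 (abs_nonneg _) h3))
    (fun n => mul_nonneg (hr n).1 (by linarith))
    (fun n => mul_le_one₀ (hr n).2.le (by linarith) (by linarith [hρ.1]))
    (fun n ω => by
      simp only [walkMean, hdyn, Finset.sum_add_distrib, ← Finset.mul_sum, Finset.sum_const,
        Finset.card_univ, Fintype.card_fin, nsmul_eq_mul]
      field_simp
      ring)
    (fun n => by
      have h1 := condExp_smul (μ := μ) (r n * ρ) (walkMean I n - walkMean Z n) (F n)
      have h2 := condExp_sub (hJi n) (hWi n) (F n)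
      rw [condExp_of_stronglyMeasurable (F.le n) (hWF n).stronglyMeasurable (hWi n)] at h2
      filter_upwards [h1, h2, hJc n] with ω h1 h2 h3
      refine Eq.trans h1 ?_
      rw [Pi.smul_apply, h2, Pi.sub_apply, h3]
      simp)
    (fun h => hrdiv (by
      have h' := h.mul_right (1 - ρ)⁻¹
      have hne : (1 - ρ) ≠ 0 := by linarith
      simpa [mul_assoc, hne] using h'))
    hrsq
  filter_upwards [key] with ω h
  have := h.add_const q
  simpa using this
end
end

section
/- Suppose N = 1 (write I_n := I_n(1)), ρ = 1, and Σ_{n≥1} exp(− Σ_{k=0}^{n} r_k²) < +∞. Then there exists a random index M such that, with probability one, the indicator variables I_n for n ≥ M all have the same value (i.e. the sequence (I_n)_{n≥1} is almost surely eventually constant). -/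
open MeasureTheory Filter Real

noncomputable section

theorem key_int {Ω : Type*} {m m0 : MeasurableSpace Ω} (μ : Measure Ω) [IsProbabilityMeasure μ]
    (hm : m ≤ m0) (W I z : Ω → ℝ) (hW : Measurable[m] W) (hWb : ∀ ω, W ω ∈ Set.Icc (0:ℝ) 1)
    (hI : Measurable[m0] I) (hIb : ∀ ω, I ω ∈ Set.Icc (0:ℝ) 1)
    (hc : μ[I | m] =ᵐ[μ] z) : ∫ ω, W ω * I ω ∂μ = ∫ ω, W ω * z ω ∂μ := by
  have hWm : Measurable[m0] W := hW.mono hm le_rfl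
  have hIi : Integrable I μ := Integrable.of_bound hI.aestronglyMeasurable 1
    (Eventually.of_forall fun ω => by
      rw [Real.norm_eq_abs, abs_of_nonneg (hIb ω).1]; exact (hIb ω).2)
  have hWI : Integrable (W * I) μ := Integrable.of_bound (hWm.mul hI).aestronglyMeasurable 1
    (Eventually.of_forall fun ω => by
      rw [Real.norm_eq_abs, Pi.mul_apply, abs_of_nonneg (mul_nonneg (hWb ω).1 (hIb ω).1)]
      exact mul_le_one₀ (hWb ω).2 (hIb ω).1 (hIb ω).2)
  have h1 := condExp_mul_of_stronglyMeasurable_left hW.stronglyMeasurable hWI hIi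
  have h2 : ∫ ω, (μ[W * I | m]) ω ∂μ = ∫ ω, (W * I) ω ∂μ := integral_condExp hm
  change ∫ ω, (W * I) ω ∂μ = _
  rw [← h2]
  apply integral_congr_ae
  filter_upwards [h1, hc] with ω a b
  rw [a, Pi.mul_apply, b]

theorem core {Ω : Type*} [m0 : MeasurableSpace Ω] (μ : Measure Ω) [IsProbabilityMeasure μ]
    (r : ℕ → ℝ) (hr : ∀ n, 0 ≤ r n ∧ r n < 1) (F : ℕ → MeasurableSpace Ω) (hF : ∀ n, F n ≤ m0)
    (Z I : ℕ → Ω → ℝ) (hZF : ∀ n, Measurable[F n] (Z n)) (hI : ∀ n, Measurable (I n))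
    (hZ01 : ∀ n ω, Z n ω ∈ Set.Icc (0:ℝ) 1)
    (hI01 : ∀ n ω, I n ω = 0 ∨ I n ω = 1)
    (hdyn : ∀ n ω, Z (n + 1) ω = (1 - r n) * Z n ω + r n * I n ω)
    (hc : ∀ n, μ[I n | F n] =ᵐ[μ] Z n)
    (hsum : Summable (fun n => Real.exp (- ∑ k ∈ Finset.range (n + 1), (r k) ^ 2))) :
    ∀ᵐ ω ∂μ, ∃ M : ℕ, ∀ m ≥ M, ∀ n ≥ M, I m ω = I n ω := by
  have hZ : ∀ n, Measurable (Z n) := fun n => (hZF n).mono (hF n) le_rfl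
  have hIb : ∀ n ω, I n ω ∈ Set.Icc (0:ℝ) 1 := fun n ω => by
    rcases hI01 n ω with h | h <;> rw [h] <;> simp
  have bi : ∀ f : Ω → ℝ, Measurable f → (∀ ω, f ω ∈ Set.Icc (0:ℝ) 1) → Integrable f μ :=
    fun f hf hb => Integrable.of_bound hf.aestronglyMeasurable 1
      (Eventually.of_forall fun ω => by
        rw [Real.norm_eq_abs, abs_of_nonneg (hb ω).1]; exact (hb ω).2)
  have mulb : ∀ f g : Ω → ℝ, (∀ ω, f ω ∈ Set.Icc (0:ℝ) 1) → (∀ ω, g ω ∈ Set.Icc (0:ℝ) 1) →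
      ∀ ω, f ω * g ω ∈ Set.Icc (0:ℝ) 1 := fun f g hf hg ω =>
    ⟨mul_nonneg (hf ω).1 (hg ω).1, mul_le_one₀ (hf ω).2 (hg ω).1 (hg ω).2⟩
  have fadd : ∀ f g : Ω → ℝ, Integrable (fun ω => f ω) μ → Integrable (fun ω => g ω) μ →
      Integrable (fun ω => f ω + g ω) μ := fun f g hf hg => hf.add hg
  have iZ : ∀ n, Integrable (fun ω => Z n ω) μ := fun n => bi _ (hZ n) (hZ01 n)
  have iI : ∀ n, Integrable (fun ω => I n ω) μ := fun n => bi _ (hI n) (hIb n)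
  have iZZ : ∀ n, Integrable (fun ω => Z n ω * Z n ω) μ := fun n =>
    bi _ ((hZ n).mul (hZ n)) (mulb _ _ (hZ01 n) (hZ01 n))
  have iZI : ∀ n, Integrable (fun ω => Z n ω * I n ω) μ := fun n =>
    bi _ ((hZ n).mul (hI n)) (mulb _ _ (hZ01 n) (hIb n))
  have eI : ∀ n, ∫ ω, I n ω ∂μ = ∫ ω, Z n ω ∂μ := fun n => by
    have := key_int μ (hF n) (fun _ => 1) (I n) (Z n) measurable_const (by simp) (hI n) (hIb n) (hc n)
    simpa using this
  have eZI : ∀ n, ∫ ω, Z n ω * I n ω ∂μ = ∫ ω, Z n ω * Z n ω ∂μ := fun n =>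
    key_int μ (hF n) (Z n) (I n) (Z n) (hZF n) (hZ01 n) (hI n) (hIb n) (hc n)
  set v : ℕ → ℝ := fun n => ∫ ω, (Z n ω - Z n ω * Z n ω) ∂μ with hv
  have hv' : ∀ n, v n = ∫ ω, Z n ω ∂μ - ∫ ω, Z n ω * Z n ω ∂μ := fun n =>
    integral_sub (iZ n) (iZZ n)
  have hv0 : ∀ n, 0 ≤ v n := fun n => integral_nonneg fun ω => by
    have := hZ01 n ω
    show 0 ≤ Z n ω - Z n ω * Z n ω
    nlinarith [this.1, this.2]
  have hstep : ∀ n, v (n+1) = (1 - r n ^ 2) * v n := by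
    intro n
    have e : ∀ ω, Z (n+1) ω - Z (n+1) ω * Z (n+1) ω =
        ((1 - r n) * Z n ω + (r n - r n ^ 2) * I n ω)
        - ((1 - r n)^2 * (Z n ω * Z n ω) + 2 * r n * (1 - r n) * (Z n ω * I n ω)) := by
      intro ω
      have h2 : I n ω * I n ω = I n ω := by rcases hI01 n ω with h | h <;> rw [h] <;> norm_num
      rw [hdyn]
      linear_combination (-(r n)^2) * h2
    have : v (n+1) = ∫ ω, (((1 - r n) * Z n ω + (r n - r n ^ 2) * I n ω)
        - ((1 - r n)^2 * (Z n ω * Z n ω) + 2 * r n * (1 - r n) * (Z n ω * I n ω))) ∂μ :=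
      integral_congr_ae (Eventually.of_forall e)
    rw [this, integral_sub (fadd _ _ ((iZ n).const_mul _) ((iI n).const_mul _))
      (fadd _ _ ((iZZ n).const_mul _) ((iZI n).const_mul _)),
      integral_add ((iZ n).const_mul _) ((iI n).const_mul _),
      integral_add ((iZZ n).const_mul _) ((iZI n).const_mul _)]
    simp only [integral_const_mul]
    rw [eI, eZI, hv']
    ring
  have hvle : ∀ n, v n ≤ Real.exp (- ∑ k ∈ Finset.range n, (r k) ^ 2) := by
    intro n
    induction n with
    | zero =>
      rw [hv']
      have h1 : ∫ ω, Z 0 ω ∂μ ≤ ∫ ω, (1:ℝ) ∂μ :=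
        integral_mono (iZ 0) (integrable_const _) fun ω => (hZ01 0 ω).2
      have h2 : 0 ≤ ∫ ω, Z 0 ω * Z 0 ω ∂μ := integral_nonneg fun ω => mul_self_nonneg _
      simp at h1 ⊢
      linarith
    | succ n ih =>
      rw [hstep, Finset.sum_range_succ, neg_add, Real.exp_add, mul_comm]
      have := Real.add_one_le_exp (-(r n)^2)
      have h3 : 0 ≤ 1 - r n ^ 2 := by nlinarith [hr n]
      apply mul_le_mul ih (by linarith) h3 (Real.exp_pos _).le
  have hvs : Summable v := by
    have h := (summable_nat_add_iff (f := fun n => Real.exp (- ∑ k ∈ Finset.range n, (r k) ^ 2)) 1).1 hsum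
    exact Summable.of_nonneg_of_le hv0 hvle h
  -- the majority indicator
  let A : ℕ → Ω → ℝ := fun n ω => if 1/2 ≤ Z n ω then 1 else 0
  have hAF : ∀ n, Measurable[F n] (A n) := fun n =>
    Measurable.ite (measurableSet_le measurable_const (hZF n)) measurable_const measurable_const
  have hA : ∀ n, Measurable (A n) := fun n => (hAF n).mono (hF n) le_rfl
  have hA01 : ∀ n ω, A n ω = 0 ∨ A n ω = 1 := fun n ω => by
    by_cases h : 1/2 ≤ Z n ω
    · right; exact if_pos h
    · left; exact if_neg h
  have hAb : ∀ n ω, A n ω ∈ Set.Icc (0:ℝ) 1 := fun n ω => by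
    rcases hA01 n ω with h | h <;> rw [h] <;> simp
  have iA : ∀ n, Integrable (fun ω => A n ω) μ := fun n => bi _ (hA n) (hAb n)
  have iAI : ∀ n, Integrable (fun ω => A n ω * I n ω) μ := fun n =>
    bi _ ((hA n).mul (hI n)) (mulb _ _ (hAb n) (hIb n))
  have iAZ : ∀ n, Integrable (fun ω => A n ω * Z n ω) μ := fun n =>
    bi _ ((hA n).mul (hZ n)) (mulb _ _ (hAb n) (hZ01 n))
  have eAI : ∀ n, ∫ ω, A n ω * I n ω ∂μ = ∫ ω, A n ω * Z n ω ∂μ := fun n =>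
    key_int μ (hF n) (A n) (I n) (Z n) (hAF n) (hAb n) (hI n) (hIb n) (hc n)
  let s : ℕ → Set Ω := fun n => {ω | I n ω ≠ A n ω}
  have hs : ∀ n, MeasurableSet (s n) := fun n => (measurableSet_eq_fun (hI n) (hA n)).compl
  have hμs : ∀ n, μ.real (s n) ≤ 2 * v n := by
    intro n
    have e1 : μ.real (s n) = ∫ ω, ((I n ω + A n ω) - 2 * (A n ω * I n ω)) ∂μ := by
      rw [← integral_indicator_one (hs n)]
      apply integral_congr_ae
      refine Eventually.of_forall fun ω => ?_
      show (s n).indicator 1 ω = _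
      by_cases h : I n ω = A n ω
      · rw [Set.indicator_of_notMem (by simpa [s] using h)]
        show (0:ℝ) = (I n ω + A n ω) - 2 * (A n ω * I n ω)
        rw [h]
        rcases hA01 n ω with h | h <;> rw [h] <;> norm_num
      · rw [Set.indicator_of_mem (by simpa [s] using h)]
        show (1:ℝ) = (I n ω + A n ω) - 2 * (A n ω * I n ω)
        rcases hA01 n ω with h1 | h1 <;> rcases hI01 n ω with h2 | h2 <;> simp_all
    have e2 : μ.real (s n) = ∫ ω, ((Z n ω + A n ω) - 2 * (A n ω * Z n ω)) ∂μ := by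
      rw [e1, integral_sub (fadd _ _ (iI n) (iA n)) ((iAI n).const_mul _),
        integral_sub (fadd _ _ (iZ n) (iA n)) ((iAZ n).const_mul _),
        integral_add (iI n) (iA n), integral_add (iZ n) (iA n),
        integral_const_mul, integral_const_mul, eAI, eI]
    rw [e2, hv, ← integral_const_mul]
    apply integral_mono (((iZ n).add (iA n)).sub ((iAZ n).const_mul _))
      (((iZ n).sub (iZZ n)).const_mul _)
    intro ω
    show (Z n ω + A n ω) - 2 * (A n ω * Z n ω) ≤ 2 * (Z n ω - Z n ω * Z n ω)
    have hz := hZ01 n ω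
    by_cases h : 1/2 ≤ Z n ω
    · have : A n ω = 1 := if_pos h
      rw [this]; nlinarith [hz.1, hz.2]
    · have : A n ω = 0 := if_neg h
      rw [this]; nlinarith [hz.1, hz.2]
  have hBC : ∑' n, μ (s n) ≠ ⊤ := by
    have h1 : Summable fun n => μ.real (s n) :=
      Summable.of_nonneg_of_le (fun n => measureReal_nonneg) hμs (hvs.mul_left 2)
    have h2 := h1.tsum_ofReal_ne_top
    simpa [ofReal_measureReal] using h2
  filter_upwards [ae_eventually_notMem hBC] with ω hω
  obtain ⟨M, hM⟩ := eventually_atTop.1 hω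
  have hM' : ∀ n ≥ M, I n ω = A n ω := fun n hn => by simpa [s] using hM n hn
  have hconst : ∀ n ≥ M, A n ω = A M ω := by
    intro n hn
    induction n, hn using Nat.le_induction with
    | base => rfl
    | succ n hn ih =>
      rw [← ih]
      have hz := hZ01 n ω
      have hd := hdyn n ω
      rw [hM' n hn] at hd
      by_cases h : 1/2 ≤ Z n ω
      · have ha : A n ω = 1 := if_pos h
        rw [ha] at hd ⊢
        exact if_pos (by nlinarith [hr n, hz.1, hz.2])
      · have ha : A n ω = 0 := if_neg h
        rw [ha] at hd ⊢
        exact if_neg (by nlinarith [hr n, hz.1, hz.2])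
  exact ⟨M, fun m hm n hn => by rw [hM' m hm, hM' n hn, hconst m hm, hconst n hn]⟩

/-- **Proposition (fixation, ρ = 1, N = 1)**: if `Σ_{n≥1} exp(-Σ_{k=0}^n r_k²) < +∞`,
then a.s. the indicators `I_n` are eventually constant. -/
theorem stmt_3
    {Ω : Type*} [MeasurableSpace Ω] (μ : Measure Ω) [IsProbabilityMeasure μ]
    (N : ℕ) (hN : 1 ≤ N)
    (ρ α q : ℝ)
    (hρ : ρ ∈ Set.Icc (0:ℝ) 1) (hα : α ∈ Set.Icc (0:ℝ) 1) (hq : q ∈ Set.Icc (0:ℝ) 1)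
    (r : ℕ → ℝ) (hr : ∀ n, 0 ≤ r n ∧ r n < 1)
    (Z : ℕ → Fin N → Ω → ℝ) (I : ℕ → Fin N → Ω → ℝ)
    (hZmeas : ∀ n i, Measurable (Z n i))
    (hImeas : ∀ n i, Measurable (I n i))
    (hZ01 : ∀ n i ω, Z n i ω ∈ Set.Icc (0:ℝ) 1)
    (hI01 : ∀ n i ω, I n i ω = 0 ∨ I n i ω = 1)
    -- dynamics: `Z_{n+1}(i) = (1 - r_n) Z_n(i) + r_n (ρ I_{n+1}(i) + (1-ρ) q)`
    -- (here `I n i` stands for `I_{n+1}(i)`)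
    (hdyn : ∀ n i ω, Z (n + 1) i ω
      = (1 - r n) * Z n i ω + r n * (ρ * I n i ω + (1 - ρ) * q))
    -- conditional independence of `I_{n+1}(1), …, I_{n+1}(N)` given `F_n`, together with
    -- the conditional law `P(I_{n+1}(i) = 1 | F_n) = (1-α) Z_n(i) + α Z_n`, expressed
    -- (equivalently, for {0,1}-valued variables) through conditional product moments
    (hcond : ∀ n (s : Finset (Fin N)),
      μ[(fun ω => ∏ i ∈ s, I n i ω) | walkFiltration Z n]
        =ᵐ[μ] fun ω => ∏ i ∈ s, ((1 - α) * Z n i ω + α * walkMean Z n ω))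
    -- the initial configuration is permutation invariant with mean 1/2 and E[Z_0(1-Z_0)] > 0
    (hperm : ∀ σ : Equiv.Perm (Fin N),
      μ.map (fun ω (i : Fin N) => Z 0 (σ i) ω) = μ.map (fun ω (i : Fin N) => Z 0 i ω))
    (hmean0 : ∀ i, ∫ ω, Z 0 i ω ∂μ = 1 / 2)
    (hvar0 : 0 < ∫ ω, walkMean Z 0 ω * (1 - walkMean Z 0 ω) ∂μ)
    (hN1 : N = 1) (hρ1 : ρ = 1)
    (hsum : Summable (fun n => Real.exp (- ∑ k ∈ Finset.range (n + 1), (r k) ^ 2))) :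
    ∀ i : Fin N, ∀ᵐ ω ∂μ, ∃ M : ℕ, ∀ m ≥ M, ∀ n ≥ M, I m i ω = I n i ω := by
  subst hN1 hρ1
  intro i
  refine core μ r hr (walkFiltration Z) ?_ (fun n => Z n i) (fun n => I n i) ?_
    (fun n => hImeas n i) (fun n => hZ01 n i) (fun n => hI01 n i) ?_ ?_ hsum
  · intro n
    refine iSup₂_le fun k _ => iSup_le fun j => ?_
    rw [← BorelSpace.measurable_eq (α := ℝ)]
    exact (hZmeas k j).comap_le
  · intro n
    rw [measurable_iff_comap_le, BorelSpace.measurable_eq (α := ℝ)]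
    exact le_iSup₂_of_le n (Finset.self_mem_range_succ n) (le_iSup_of_le i le_rfl)
  · intro n ω
    rw [hdyn]; ring
  · intro n
    have h := hcond n {i}
    simp only [Finset.prod_singleton] at h
    refine h.trans (Eventually.of_forall fun ω => ?_)
    have hi : i = 0 := Subsingleton.elim _ _
    subst hi
    simp [walkMean]
    ring
end
end

section
/- Suppose ρ = 1, α > 0, and there exist constants c > 0 and γ ∈ (1/2, 1] with lim_n n^γ r_n = c. Let Z be the almost sure limit of the martingale Z_n. Then, for every bounded continuous function f : ℝ → ℝ, the conditional expectations E[ f( n^{γ−1/2}(Z_n − Z) ) | F_n ] converge almost surely, as n → ∞, to ∫ f dN(0, v), where v is the random variance v := c² Z(1 − Z) / (N(2γ − 1)) and N(0, v) denotes the centered Gaussian distribution on ℝ with variance v (the Dirac mass at 0 when v = 0). In other words, n^{γ−1/2}(Z_n − Z) converges to the Gaussian kernel N(0, c² Z(1−Z)/(N(2γ−1))) in the sense of almost sure conditional convergence with respect to the filtration (F_n). -/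
open MeasureTheory Filter Real

noncomputable section

lemma ib' {Ω : Type*} [m0 : MeasurableSpace Ω] {μ : Measure Ω} [IsFiniteMeasure μ] {f : Ω → ℝ} (C : ℝ)
    (hf : Measurable f) (hb : ∀ ω, |f ω| ≤ C) : Integrable f μ :=
  Integrable.of_bound hf.aestronglyMeasurable C (ae_of_all _ hb)

lemma iadd3 {Ω : Type*} [m0 : MeasurableSpace Ω] {μ : Measure Ω} {f g h : Ω → ℝ}
    (hf : Integrable f μ) (hg : Integrable g μ) (hh : Integrable h μ) :
    ∫ ω, (f ω + g ω + h ω) ∂μ = ∫ ω, f ω ∂μ + ∫ ω, g ω ∂μ + ∫ ω, h ω ∂μ := by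
  have : Integrable (fun ω => f ω + g ω) μ := hf.add hg
  rw [integral_add this hh, integral_add hf hg]

set_option linter.unusedSectionVars false

lemma cos_taylor (y d : ℝ) :
    |cos (y + d) - (cos y - d * sin y - d ^ 2 / 2 * cos y)| ≤ 4 * |d| ^ 3 := by
  have e : cos (y + d) - (cos y - d * sin y - d ^ 2 / 2 * cos y)
      = cos y * (cos d - (1 - d ^ 2 / 2)) - sin y * (sin d - d) := by
    rw [cos_add]; ring
  have h1 : |cos y| ≤ 1 := abs_cos_le_one y
  have h2 : |sin y| ≤ 1 := abs_sin_le_one y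
  have h3 : |cos (y + d) - (cos y - d * sin y - d ^ 2 / 2 * cos y)|
      ≤ |cos d - (1 - d ^ 2 / 2)| + |sin d - d| := by
    rw [e]
    refine (abs_sub _ _).trans ?_
    rw [abs_mul, abs_mul]
    have := abs_nonneg (cos d - (1 - d ^ 2 / 2))
    have := abs_nonneg (sin d - d)
    nlinarith
  refine h3.trans ?_
  have hd := abs_nonneg d
  rcases le_or_gt |d| 1 with h | h
  · have a1 := Real.cos_bound h
    have a2 := Real.sin_bound h
    have a3 : |sin d - d| ≤ |d| ^ 3 / 6 + |d| ^ 5 / 100 := by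
      have : sin d - d = (sin d - (d - d ^ 3 / 6)) - d ^ 3 / 6 := by ring
      rw [this]
      refine (abs_sub _ _).trans ?_
      have : |d ^ 3 / 6| = |d| ^ 3 / 6 := by rw [abs_div, abs_pow]; norm_num
      rw [this]; linarith
    have a4 : |d| ^ 4 ≤ |d| ^ 3 := pow_le_pow_of_le_one hd h (by norm_num)
    have a5 : |d| ^ 5 ≤ |d| ^ 3 := pow_le_pow_of_le_one hd h (by norm_num)
    have : 0 ≤ |d| ^ 3 := by positivity
    linarith
  · have c1 : |cos d - (1 - d ^ 2 / 2)| ≤ |d| ^ 2 / 2 := by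
      rw [sq_abs, abs_le]
      constructor
      · have := one_sub_sq_div_two_le_cos (x := d); nlinarith [sq_nonneg d]
      · linarith [cos_le_one d]
    have a2 : |sin d - d| ≤ 1 + |d| := by
      refine (abs_sub _ _).trans ?_
      linarith [abs_sin_le_one d]
    have : 1 ≤ |d| ^ 3 := one_le_pow₀ h.le
    have b1 : |d| ≤ |d| ^ 3 := by simpa using pow_le_pow_right₀ h.le (show 1 ≤ 3 by norm_num)
    have b2 : |d| ^ 2 ≤ |d| ^ 3 := pow_le_pow_right₀ h.le (show 2 ≤ 3 by norm_num)
    linarith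

lemma exp_taylor (z : ℝ) (hz : 0 ≤ z) : |exp (-z) - (1 - z)| ≤ z ^ 2 := by
  rcases le_or_gt z 1 with h | h
  · have := Real.abs_exp_sub_one_sub_id_le (x := -z) (by rwa [abs_neg, abs_of_nonneg hz])
    rw [show exp (-z) - (1 - z) = exp (-z) - 1 - (-z) by ring]
    simpa using this
  · have h1 := exp_pos (-z)
    have h2 : exp (-z) ≤ 1 := exp_le_one_iff.2 (by linarith)
    rw [abs_le]; constructor <;> nlinarith

/-- the abstract system -/
structure Sys {Ω : Type*} [m0 : MeasurableSpace Ω] (μ : Measure Ω) (F : Filtration ℕ m0)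
    (r : ℕ → ℝ) (M L : ℕ → Ω → ℝ) (α b κ K : ℝ) : Prop where
  hr : ∀ n, 0 ≤ r n ∧ r n < 1
  hα : 0 < α ∧ α ≤ 1
  hb : 0 ≤ b ∧ b ≤ 1
  hκ : 0 ≤ κ ∧ κ ≤ 1
  hK : 0 ≤ K
  Mm : ∀ n, Measurable[F n] (M n)
  Lm : ∀ n, Measurable[F n] (L n)
  M01 : ∀ n ω, 0 ≤ M n ω ∧ M n ω ≤ 1
  L01 : ∀ n ω, 0 ≤ L n ω ∧ L n ω ≤ K
  step : ∀ n ω, |M (n + 1) ω - M n ω| ≤ r n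
  mart : ∀ n (ξ : Ω → ℝ) (C : ℝ), Measurable[F n] ξ → (∀ ω, |ξ ω| ≤ C) →
    ∫ ω, ξ ω * (M (n + 1) ω - M n ω) ∂μ = 0
  var : ∀ n (ξ : Ω → ℝ) (C : ℝ), Measurable[F n] ξ → (∀ ω, |ξ ω| ≤ C) →
    ∫ ω, ξ ω * (M (n + 1) ω - M n ω) ^ 2 ∂μ
      = ∫ ω, ξ ω * (r n ^ 2 * (b * (M n ω * (1 - M n ω)) - κ * L n ω)) ∂μ
  Lrec : ∀ n (ξ : Ω → ℝ) (C : ℝ), Measurable[F n] ξ → (∀ ω, 0 ≤ ξ ω ∧ ξ ω ≤ C) →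
    ∫ ω, ξ ω * L (n + 1) ω ∂μ ≤ ∫ ω, ξ ω * ((1 - α * r n) * L n ω + K * r n ^ 2) ∂μ

section
variable {Ω : Type*} [m0 : MeasurableSpace Ω] {μ : Measure Ω} [IsProbabilityMeasure μ]
  {F : Filtration ℕ m0} {r : ℕ → ℝ} {M L : ℕ → Ω → ℝ} {α b κ K : ℝ}

lemma Sys.M0 (h : Sys μ F r M L α b κ K) (n : ℕ) : Measurable (M n) := (h.Mm n).mono (F.le n) le_rfl
lemma Sys.L0 (h : Sys μ F r M L α b κ K) (n : ℕ) : Measurable (L n) := (h.Lm n).mono (F.le n) le_rfl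
lemma Sys.Mk (h : Sys μ F r M L α b κ K) {n k : ℕ} (hk : n ≤ k) : Measurable[F k] (M n) :=
  (h.Mm n).mono (F.mono hk) le_rfl

lemma Sys.Msub (h : Sys μ F r M L α b κ K) (n k : ℕ) (ω : Ω) : |M k ω - M n ω| ≤ 1 := by
  have := h.M01 n ω; have := h.M01 k ω
  rw [abs_le]; constructor <;> linarith

lemma Sys.sq_bound (h : Sys μ F r M L α b κ K) {S : ℕ → ℝ} (hS : ∀ n, S n = r n ^ 2 + S (n + 1))
    (n : ℕ) (w : Ω → ℝ) (hw : Measurable[F n] w) (hw01 : ∀ ω, 0 ≤ w ω ∧ w ω ≤ 1)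
    (k : ℕ) (hk : n ≤ k) :
    ∫ ω, w ω * (M k ω - M n ω) ^ 2 ∂μ ≤ (S n - S k) * ∫ ω, w ω ∂μ := by
  have hw0 : Measurable w := hw.mono (F.le n) le_rfl
  have hwi : Integrable w μ := ib' 1 hw0 (fun ω => abs_le.2 ⟨by linarith [(hw01 ω).1], (hw01 ω).2⟩)
  induction k, hk using Nat.le_induction with
  | base => simp
  | succ k hk ih =>
    have hM := h.M0
    have e0 : ∀ ω, |w ω * (M k ω - M n ω) ^ 2| ≤ 1 := by
      intro ω
      have := h.Msub n k ω
      rw [abs_mul, abs_pow, abs_of_nonneg (hw01 ω).1]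
      exact mul_le_one₀ (hw01 ω).2 (by positivity) (pow_le_one₀ (abs_nonneg _) this)
    have e1 : ∀ ω, |2 * w ω * (M k ω - M n ω)| ≤ 2 := by
      intro ω
      have := h.Msub n k ω
      rw [abs_mul, abs_mul, abs_of_nonneg (hw01 ω).1]
      have := mul_le_one₀ (hw01 ω).2 (abs_nonneg _) this
      norm_num; linarith
    have m1 : Measurable[F k] (fun ω => 2 * w ω * (M k ω - M n ω)) := by
      have a := hw.mono (F.mono hk) le_rfl
      have b := h.Mm k
      have c := h.Mk hk
      exact (a.const_mul 2).mul (b.sub c)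
    have m2 := h.mart k _ 2 m1 e1
    have i1 : Integrable (fun ω => w ω * (M k ω - M n ω) ^ 2) μ :=
      ib' 1 (by have := hM k; have := hM n; fun_prop) e0
    have i2 : Integrable (fun ω => 2 * w ω * (M k ω - M n ω) * (M (k + 1) ω - M k ω)) μ := by
      refine ib' 2 (by have := hM k; have := hM n; have := hM (k+1); fun_prop) fun ω => ?_
      rw [abs_mul]
      have := e1 ω; have := h.Msub k (k+1) ω
      have := abs_nonneg (2 * w ω * (M k ω - M n ω))
      have := abs_nonneg (M (k+1) ω - M k ω)
      nlinarith
    have i3 : Integrable (fun ω => r k ^ 2 * w ω) μ := hwi.const_mul _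
    have i4 : Integrable (fun ω => w ω * (M (k + 1) ω - M n ω) ^ 2) μ := by
      refine ib' 1 (by have := hM (k+1); have := hM n; fun_prop) fun ω => ?_
      have := h.Msub n (k+1) ω
      rw [abs_mul, abs_pow, abs_of_nonneg (hw01 ω).1]
      exact mul_le_one₀ (hw01 ω).2 (by positivity) (pow_le_one₀ (abs_nonneg _) this)
    calc ∫ ω, w ω * (M (k + 1) ω - M n ω) ^ 2 ∂μ
        ≤ ∫ ω, (w ω * (M k ω - M n ω) ^ 2 + 2 * w ω * (M k ω - M n ω) * (M (k + 1) ω - M k ω)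
            + r k ^ 2 * w ω) ∂μ := by
          refine integral_mono i4 ((i1.add i2).add i3) fun ω => ?_
          have hs : (M (k + 1) ω - M k ω) ^ 2 ≤ r k ^ 2 := by
            rw [← sq_abs]; exact pow_le_pow_left₀ (abs_nonneg _) (h.step k ω) 2
          have := mul_le_mul_of_nonneg_left hs (hw01 ω).1
          simp only
          nlinarith
      _ = ∫ ω, w ω * (M k ω - M n ω) ^ 2 ∂μ + 0 + r k ^ 2 * ∫ ω, w ω ∂μ := by
          rw [iadd3 i1 i2 i3, m2, integral_const_mul]
      _ ≤ _ := by
          have h3 : S n - S (k+1) = (S n - S k) + r k ^ 2 := by linarith [hS k]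
          rw [h3]
          nlinarith

lemma Sys.L_bound (h : Sys μ F r M L α b κ K) {S : ℕ → ℝ} (hS : ∀ n, S n = r n ^ 2 + S (n + 1))
    (n : ℕ) (w : Ω → ℝ) (hw : Measurable[F n] w) (hw01 : ∀ ω, 0 ≤ w ω ∧ w ω ≤ 1)
    (k : ℕ) (hk : n ≤ k) :
    ∫ ω, w ω * L k ω ∂μ ≤ ∫ ω, w ω * L n ω ∂μ + K * (S n - S k) * ∫ ω, w ω ∂μ := by
  have hw0 : Measurable w := hw.mono (F.le n) le_rfl
  have hwi : Integrable w μ := ib' 1 hw0 (fun ω => abs_le.2 ⟨by linarith [(hw01 ω).1], (hw01 ω).2⟩)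
  have hwL : ∀ k, Integrable (fun ω => w ω * L k ω) μ := by
    intro k
    refine ib' K (by have := h.L0 k; fun_prop) fun ω => ?_
    have := h.L01 k ω; have := hw01 ω
    rw [abs_le]; constructor <;> nlinarith
  induction k, hk using Nat.le_induction with
  | base => simp
  | succ k hk ih =>
    have h1 := h.Lrec k w 1 (hw.mono (F.mono hk) le_rfl) hw01
    have h2 : ∫ ω, w ω * ((1 - α * r k) * L k ω + K * r k ^ 2) ∂μ
        ≤ ∫ ω, (w ω * L k ω + K * r k ^ 2 * w ω) ∂μ := by
      refine integral_mono ?_ ((hwL k).add (hwi.const_mul _)) fun ω => ?_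
      · have : (fun ω => w ω * ((1 - α * r k) * L k ω + K * r k ^ 2))
          = fun ω => (1 - α * r k) * (w ω * L k ω) + K * r k ^ 2 * w ω := by ext; ring
        rw [this]
        exact ((hwL k).const_mul _).add (hwi.const_mul _)
      · have : 0 ≤ α * r k * (w ω * L k ω) :=
          mul_nonneg (mul_nonneg h.hα.1.le (h.hr k).1) (mul_nonneg (hw01 ω).1 (h.L01 k ω).1)
        simp only
        nlinarith
    rw [integral_add (hwL k) (hwi.const_mul _), integral_const_mul] at h2
    have := hS k
    have h3 : S n - S (k+1) = (S n - S k) + r k ^ 2 := by linarith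
    rw [h3]
    nlinarith
end

lemma pt_ineq (E y s D r u U z X : ℝ) (hE : 0 ≤ E ∧ E ≤ 1) (hD : |D| ≤ r) (hu : 0 ≤ u ∧ u ≤ 1)
    (hz : z = s ^ 2 / 2 * r ^ 2 * u) (hX : |U - u| ≤ X) :
    cos (y - s * D) * E - cos y * (E * exp (-z)) ≤
      E * sin y * s * D - E * cos y * (s ^ 2 / 2) * (D ^ 2 - r ^ 2 * U)
      + (s ^ 2 / 2 * r ^ 2 * X + 4 * |s| ^ 3 * r ^ 3 + s ^ 4 * r ^ 4) := by
  have hz0 : 0 ≤ z := by rw [hz]; exact mul_nonneg (by positivity) hu.1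
  have h1 := cos_taylor y (-(s * D))
  have h2 := exp_taylor z hz0
  rw [← sub_eq_add_neg] at h1
  set R1 := cos (y - s * D) - (cos y - -(s * D) * sin y - (-(s * D)) ^ 2 / 2 * cos y) with hR1
  set R2 := exp (-z) - (1 - z) with hR2
  have e1 : cos (y - s * D) = cos y - -(s * D) * sin y - (-(s * D)) ^ 2 / 2 * cos y + R1 := by
    rw [hR1]; ring
  have e2 : exp (-z) = 1 - z + R2 := by rw [hR2]; ring
  rw [e1, e2]
  have hr : 0 ≤ r := (abs_nonneg _).trans hD
  have b1 : |R1| ≤ 4 * |s| ^ 3 * r ^ 3 := by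
    refine h1.trans ?_
    rw [abs_neg, abs_mul, mul_pow]
    have : |D| ^ 3 ≤ r ^ 3 := pow_le_pow_left₀ (abs_nonneg _) hD 3
    have := mul_le_mul_of_nonneg_left this (show 0 ≤ 4 * |s| ^ 3 by positivity)
    linarith
  have b2 : |R2| ≤ s ^ 4 * r ^ 4 := by
    refine h2.trans ?_
    have : z ≤ s ^ 2 * r ^ 2 := by
      rw [hz]
      have : 0 ≤ s ^ 2 * r ^ 2 := by positivity
      nlinarith [hu.1, hu.2]
    calc z ^ 2 ≤ (s ^ 2 * r ^ 2) ^ 2 := pow_le_pow_left₀ hz0 this 2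
      _ = _ := by ring
  have hc : |cos y| ≤ 1 := abs_cos_le_one y
  have b3 : |s ^ 2 / 2 * r ^ 2 * (cos y * (U - u)) - R1 + cos y * R2|
      ≤ s ^ 2 / 2 * r ^ 2 * X + 4 * |s| ^ 3 * r ^ 3 + s ^ 4 * r ^ 4 := by
    refine (abs_add_le _ _).trans (add_le_add ((abs_sub _ _).trans (add_le_add ?_ b1)) ?_)
    · rw [abs_mul, abs_mul (cos y), abs_of_nonneg (show 0 ≤ s ^ 2 / 2 * r ^ 2 by positivity)]
      refine mul_le_mul_of_nonneg_left ?_ (by positivity)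
      calc |cos y| * |U - u| ≤ 1 * X := mul_le_mul hc hX (abs_nonneg _) zero_le_one
        _ = X := one_mul X
    · rw [abs_mul]
      calc |cos y| * |R2| ≤ 1 * (s ^ 4 * r ^ 4) := mul_le_mul hc b2 (abs_nonneg _) zero_le_one
        _ = _ := one_mul _
  set T := s ^ 2 / 2 * r ^ 2 * (cos y * (U - u)) - R1 + cos y * R2 with hT
  set err := s ^ 2 / 2 * r ^ 2 * X + 4 * |s| ^ 3 * r ^ 3 + s ^ 4 * r ^ 4
  have b4 : -err ≤ E * T := by
    have : |E * T| ≤ err := by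
      rw [abs_mul, abs_of_nonneg hE.1]
      calc E * |T| ≤ 1 * err := mul_le_mul hE.2 b3 (abs_nonneg _) zero_le_one
        _ = err := one_mul _
    exact (abs_le.1 this).1
  have e3 : E * sin y * s * D - E * cos y * (s ^ 2 / 2) * (D ^ 2 - r ^ 2 * U) + err
      - ((cos y - -(s * D) * sin y - (-(s * D)) ^ 2 / 2 * cos y + R1) * E
        - cos y * (E * (1 - z + R2))) = E * T + err := by
    rw [hT, hz]; ring
  linarith

section
variable {Ω : Type*} [m0 : MeasurableSpace Ω] {μ : Measure Ω} [IsProbabilityMeasure μ]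
  {F : Filtration ℕ m0} {r : ℕ → ℝ} {M L : ℕ → Ω → ℝ} {α b κ K : ℝ}

def GG (M : ℕ → Ω → ℝ) (S : ℕ → ℝ) (b s θ : ℝ) (n k : ℕ) (ω : Ω) : ℝ :=
  cos (θ + s * (M n ω - M k ω)) * exp (-(s ^ 2 / 2 * S k * (b * (M n ω * (1 - M n ω)))))

lemma Sys.u01 (h : Sys μ F r M L α b κ K) (n : ℕ) (ω : Ω) :
    0 ≤ b * (M n ω * (1 - M n ω)) ∧ b * (M n ω * (1 - M n ω)) ≤ 1 := by
  obtain ⟨h1, h2⟩ := h.M01 n ω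
  obtain ⟨h3, h4⟩ := h.hb
  have : 0 ≤ M n ω * (1 - M n ω) := mul_nonneg h1 (by linarith)
  have : M n ω * (1 - M n ω) ≤ 1 := by nlinarith
  exact ⟨by positivity, by nlinarith⟩

lemma Sys.UU (h : Sys μ F r M L α b κ K) (n k : ℕ) (ω : Ω) :
    |(b * (M k ω * (1 - M k ω)) - κ * L k ω) - b * (M n ω * (1 - M n ω))|
      ≤ |M k ω - M n ω| + L k ω := by
  obtain ⟨h1, h2⟩ := h.M01 n ω
  obtain ⟨h1', h2'⟩ := h.M01 k ω
  obtain ⟨h3, h4⟩ := h.hb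
  obtain ⟨h5, h6⟩ := h.hκ
  obtain ⟨h7, h8⟩ := h.L01 k ω
  have e : (b * (M k ω * (1 - M k ω)) - κ * L k ω) - b * (M n ω * (1 - M n ω))
    = b * (1 - M k ω - M n ω) * (M k ω - M n ω) - κ * L k ω := by ring
  rw [e]
  refine (abs_sub _ _).trans (add_le_add ?_ ?_)
  · rw [abs_mul, abs_mul, abs_of_nonneg h3]
    have : |1 - M k ω - M n ω| ≤ 1 := by rw [abs_le]; constructor <;> linarith
    have : b * |1 - M k ω - M n ω| ≤ 1 := mul_le_one₀ h4 (abs_nonneg _) this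
    have := mul_le_mul_of_nonneg_right this (abs_nonneg (M k ω - M n ω))
    linarith
  · rw [abs_of_nonneg (by positivity)]
    nlinarith

lemma GG_meas (M : ℕ → Ω → ℝ) (hM : ∀ n, Measurable (M n)) (S : ℕ → ℝ) (b s θ : ℝ) (n k : ℕ) :
    Measurable (GG M S b s θ n k) := by
  have := hM n; have := hM k
  unfold GG; fun_prop

lemma Sys.GG_bd (h : Sys μ F r M L α b κ K) {S : ℕ → ℝ} (hS0 : ∀ n, 0 ≤ S n) (s θ : ℝ) (n k : ℕ)
    (ω : Ω) : |GG M S b s θ n k ω| ≤ 1 := by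
  unfold GG
  rw [abs_mul, abs_of_pos (exp_pos _)]
  refine mul_le_one₀ (abs_cos_le_one _) (exp_pos _).le (exp_le_one_iff.2 ?_)
  have := mul_nonneg (mul_nonneg (show 0 ≤ s ^ 2 / 2 by positivity) (hS0 k)) (h.u01 n ω).1
  linarith

lemma Sys.onestep (h : Sys μ F r M L α b κ K) {S : ℕ → ℝ} (hS : ∀ n, S n = r n ^ 2 + S (n + 1))
    (hS0 : ∀ n, 0 ≤ S n)
    (n : ℕ) (w : Ω → ℝ) (hw : Measurable[F n] w) (hw01 : ∀ ω, 0 ≤ w ω ∧ w ω ≤ 1)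
    (k : ℕ) (hk : n ≤ k) (s θ η m : ℝ) (hη : 0 < η) (hηS : S n ≤ η ^ 2)
    (hm : r k ≤ m) :
    ∫ ω, w ω * GG M S b s θ n (k + 1) ω ∂μ ≤ ∫ ω, w ω * GG M S b s θ n k ω ∂μ
      + r k ^ 2 * ∫ ω, w ω * (s ^ 2 / 2 * (2 * η + L n ω + K * S n)
        + 4 * |s| ^ 3 * m + s ^ 4 * m ^ 2) ∂μ := by
  have hw0 : Measurable w := hw.mono (F.le n) le_rfl
  have hM := h.M0
  have hL := h.L0
  have hMn := hM n
  have hMk := hM k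
  have hMk1 := hM (k + 1)
  have hLk := hL k
  have hLn := hL n
  have hwa : ∀ ω, |w ω| ≤ 1 := fun ω => abs_le.2 ⟨by linarith [(hw01 ω).1], (hw01 ω).2⟩
  have hwi : Integrable w μ := ib' 1 hw0 hwa
  set u : Ω → ℝ := fun ω => b * (M n ω * (1 - M n ω)) with hu
  set U : Ω → ℝ := fun ω => b * (M k ω * (1 - M k ω)) - κ * L k ω with hU
  set E : Ω → ℝ := fun ω => exp (-(s ^ 2 / 2 * S (k + 1) * u ω)) with hE
  set y : Ω → ℝ := fun ω => θ + s * (M n ω - M k ω) with hy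
  have hE01 : ∀ ω, 0 ≤ E ω ∧ E ω ≤ 1 := fun ω => by
    refine ⟨(exp_pos _).le, exp_le_one_iff.2 ?_⟩
    have := mul_nonneg (mul_nonneg (show 0 ≤ s ^ 2 / 2 by positivity) (hS0 (k + 1))) (h.u01 n ω).1
    simp only [hu]; linarith
  set x1 : Ω → ℝ := fun ω => w ω * (E ω * sin (y ω) * s) with hx1
  set x2 : Ω → ℝ := fun ω => w ω * (E ω * cos (y ω) * (s ^ 2 / 2)) with hx2
  have mwk : Measurable[F k] w := hw.mono (F.mono hk) le_rfl
  have mMk : Measurable[F k] (M k) := h.Mm k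
  have mMn : Measurable[F k] (M n) := h.Mk hk
  have x1m : Measurable[F k] x1 := by
    simp only [hx1, hE, hy, hu]; fun_prop
  have x2m : Measurable[F k] x2 := by
    simp only [hx2, hE, hy, hu]; fun_prop
  have x1b : ∀ ω, |x1 ω| ≤ |s| := fun ω => by
    simp only [hx1, abs_mul]
    have a1 : |w ω| * (|E ω| * |sin (y ω)|) ≤ 1 := by
      rw [abs_of_nonneg (hE01 ω).1]
      exact mul_le_one₀ (hwa ω) (mul_nonneg (hE01 ω).1 (abs_nonneg _))
        (mul_le_one₀ (hE01 ω).2 (abs_nonneg _) (abs_sin_le_one _))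
    have := mul_le_mul_of_nonneg_right a1 (abs_nonneg s)
    linarith
  have x2b : ∀ ω, |x2 ω| ≤ s ^ 2 / 2 := fun ω => by
    simp only [hx2, abs_mul]
    have a1 : |w ω| * (|E ω| * |cos (y ω)|) ≤ 1 := by
      rw [abs_of_nonneg (hE01 ω).1]
      exact mul_le_one₀ (hwa ω) (mul_nonneg (hE01 ω).1 (abs_nonneg _))
        (mul_le_one₀ (hE01 ω).2 (abs_nonneg _) (abs_cos_le_one _))
    rw [abs_of_nonneg (show 0 ≤ s ^ 2 / 2 by positivity)]
    have := mul_le_mul_of_nonneg_right a1 (show 0 ≤ s ^ 2 / 2 by positivity)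
    linarith
  have A1 := h.mart k x1 _ x1m x1b
  have A2 := h.var k x2 _ x2m x2b
  have x1m0 : Measurable x1 := x1m.mono (F.le k) le_rfl
  have x2m0 : Measurable x2 := x2m.mono (F.le k) le_rfl
  have x1i : Integrable x1 μ := ib' _ x1m0 x1b
  have x2i : Integrable x2 μ := ib' _ x2m0 x2b
  have j1 : Integrable (fun ω => x1 ω * (M (k + 1) ω - M k ω)) μ :=
    x1i.mul_bdd (c := 1) (by fun_prop) (ae_of_all _ fun ω => h.Msub k (k+1) ω)
  have j2 : Integrable (fun ω => x2 ω * (M (k + 1) ω - M k ω) ^ 2) μ :=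
    x2i.mul_bdd (c := 1) (by fun_prop) (ae_of_all _ fun ω => by
      rw [norm_pow]; exact pow_le_one₀ (norm_nonneg _) (h.Msub k (k+1) ω))
  have hUb : ∀ ω, |U ω| ≤ 1 + K := fun ω => by
    have a1 := h.u01 k ω; have a2 := h.L01 k ω
    have := h.hκ; have := h.hK
    have : κ * L k ω ≤ K := by nlinarith
    have : 0 ≤ κ * L k ω := mul_nonneg h.hκ.1 a2.1
    simp only [hU]; rw [abs_le]; constructor <;> linarith
  have j3 : Integrable (fun ω => x2 ω * (r k ^ 2 * U ω)) μ :=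
    x2i.mul_bdd (c := r k ^ 2 * (1 + K)) (by simp only [hU]; fun_prop) (ae_of_all _ fun ω => by
      rw [norm_mul, Real.norm_eq_abs, Real.norm_eq_abs, abs_of_nonneg (sq_nonneg (r k))]
      exact mul_le_mul_of_nonneg_left (hUb ω) (sq_nonneg _))
  have gi : ∀ k, Integrable (fun ω => w ω * GG M S b s θ n k ω) μ := fun k =>
    hwi.mul_bdd (c := 1) (GG_meas M hM S b s θ n k).aestronglyMeasurable
      (ae_of_all _ fun ω => h.GG_bd hS0 s θ n k ω)
  have hrk := (h.hr k).1
  have hm0 : 0 ≤ m := hrk.trans hm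
  -- the bound with squares
  set B : Ω → ℝ := fun ω => w ω * (s ^ 2 / 2 * ((η + (M k ω - M n ω) ^ 2 / η) + L k ω)
        + 4 * |s| ^ 3 * m + s ^ 4 * m ^ 2) with hB
  have wq : Integrable (fun ω => w ω * (M k ω - M n ω) ^ 2) μ :=
    hwi.mul_bdd (c := 1) (by fun_prop) (ae_of_all _ fun ω => by
      rw [norm_pow]; exact pow_le_one₀ (norm_nonneg _) (h.Msub n k ω))
  have wL : ∀ k, Integrable (fun ω => w ω * L k ω) μ := fun k =>
    hwi.mul_bdd (c := K) (hL k).aestronglyMeasurable (ae_of_all _ fun ω => by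
      rw [Real.norm_eq_abs, abs_of_nonneg (h.L01 k ω).1]; exact (h.L01 k ω).2)
  set c0 : ℝ := s ^ 2 / 2 * η + 4 * |s| ^ 3 * m + s ^ 4 * m ^ 2 with hc0
  have Beq : B = fun ω => c0 * w ω + (s ^ 2 / 2 / η) * (w ω * (M k ω - M n ω) ^ 2)
      + s ^ 2 / 2 * (w ω * L k ω) := by
    ext ω; simp only [hB, hc0]; field_simp; ring
  have Bi : Integrable B μ := by
    rw [Beq]; exact ((hwi.const_mul _).add (wq.const_mul _)).add ((wL k).const_mul _)
  have key : ∀ ω, w ω * GG M S b s θ n (k + 1) ω - w ω * GG M S b s θ n k ω ≤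
      x1 ω * (M (k + 1) ω - M k ω) - (x2 ω * (M (k + 1) ω - M k ω) ^ 2 - x2 ω * (r k ^ 2 * U ω))
        + r k ^ 2 * B ω := by
    intro ω
    have p := pt_ineq (E ω) (y ω) s (M (k + 1) ω - M k ω) (r k) (u ω) (U ω)
      (s ^ 2 / 2 * r k ^ 2 * u ω) (|M k ω - M n ω| + L k ω) (hE01 ω) (h.step k ω) (h.u01 n ω) rfl
      (h.UU n k ω)
    have g1 : GG M S b s θ n (k + 1) ω = cos (y ω - s * (M (k + 1) ω - M k ω)) * E ω := by
      simp only [GG, hE, hy, hu]; congr 2; ring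
    have g2 : GG M S b s θ n k ω = cos (y ω) * (E ω * exp (-(s ^ 2 / 2 * r k ^ 2 * u ω))) := by
      simp only [GG, hE, hy, hu]
      rw [← exp_add, hS k]; congr 2; ring
    rw [← g1, ← g2] at p
    have q1 : |M k ω - M n ω| ≤ η + (M k ω - M n ω) ^ 2 / η := by
      rw [← sq_abs]
      set a := |M k ω - M n ω|
      have : η + a ^ 2 / η - a = ((η - a) ^ 2 + a * η) / η := by field_simp; ring
      have : 0 ≤ ((η - a) ^ 2 + a * η) / η := by
        have : 0 ≤ a := abs_nonneg _
        positivity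
      linarith
    have q2 : s ^ 2 / 2 * r k ^ 2 * (|M k ω - M n ω| + L k ω) + 4 * |s| ^ 3 * r k ^ 3 + s ^ 4 * r k ^ 4
        ≤ r k ^ 2 * (s ^ 2 / 2 * ((η + (M k ω - M n ω) ^ 2 / η) + L k ω)
        + 4 * |s| ^ 3 * m + s ^ 4 * m ^ 2) := by
      have t1 : s ^ 2 / 2 * r k ^ 2 * (|M k ω - M n ω| + L k ω)
          ≤ s ^ 2 / 2 * r k ^ 2 * ((η + (M k ω - M n ω) ^ 2 / η) + L k ω) := by gcongr
      have t2 : 4 * |s| ^ 3 * r k ^ 3 ≤ 4 * |s| ^ 3 * (r k ^ 2 * m) := by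
        have : r k ^ 3 = r k ^ 2 * r k := by ring
        rw [this]; gcongr
      have t3 : s ^ 4 * r k ^ 4 ≤ s ^ 4 * (r k ^ 2 * m ^ 2) := by
        have : r k ^ 4 = r k ^ 2 * r k ^ 2 := by ring
        rw [this]; gcongr
      linarith
    have q3 := mul_le_mul_of_nonneg_left (p.trans (add_le_add_right q2 _)) (hw01 ω).1
    simp only [hx1, hx2, hB]
    linarith
  have I1 : ∫ ω, (w ω * GG M S b s θ n (k + 1) ω - w ω * GG M S b s θ n k ω) ∂μ ≤
      ∫ ω, (x1 ω * (M (k + 1) ω - M k ω) - (x2 ω * (M (k + 1) ω - M k ω) ^ 2 - x2 ω * (r k ^ 2 * U ω))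
        + r k ^ 2 * B ω) ∂μ :=
    integral_mono ((gi _).sub (gi _)) ((j1.sub (j2.sub j3)).add (Bi.const_mul _)) key
  have j23 : Integrable (fun ω => x2 ω * (M (k + 1) ω - M k ω) ^ 2 - x2 ω * (r k ^ 2 * U ω)) μ :=
    j2.sub j3
  have j123 : Integrable (fun ω => x1 ω * (M (k + 1) ω - M k ω) -
      (x2 ω * (M (k + 1) ω - M k ω) ^ 2 - x2 ω * (r k ^ 2 * U ω))) μ := j1.sub j23
  rw [integral_sub (gi _) (gi _), integral_add j123 (Bi.const_mul _), integral_sub j1 j23,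
    integral_sub j2 j3, A1, A2, integral_const_mul] at I1
  have I2 : ∫ ω, B ω ∂μ ≤ ∫ ω, w ω * (s ^ 2 / 2 * (2 * η + L n ω + K * S n)
        + 4 * |s| ^ 3 * m + s ^ 4 * m ^ 2) ∂μ := by
    have e1 : ∫ ω, B ω ∂μ = c0 * ∫ ω, w ω ∂μ + (s ^ 2 / 2 / η) * ∫ ω, w ω * (M k ω - M n ω) ^ 2 ∂μ
        + s ^ 2 / 2 * ∫ ω, w ω * L k ω ∂μ := by
      rw [Beq, iadd3 (hwi.const_mul _) (wq.const_mul _) ((wL k).const_mul _)]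
      simp only [integral_const_mul]
    have e2 : ∫ ω, w ω * (s ^ 2 / 2 * (2 * η + L n ω + K * S n)
        + 4 * |s| ^ 3 * m + s ^ 4 * m ^ 2) ∂μ
        = (c0 + s ^ 2 / 2 * η + s ^ 2 / 2 * (K * S n)) * ∫ ω, w ω ∂μ + s ^ 2 / 2 * ∫ ω, w ω * L n ω ∂μ := by
      rw [← integral_const_mul, ← integral_const_mul,
        ← integral_add (hwi.const_mul _) ((wL n).const_mul _)]
      congr 1; ext ω; simp only [hc0]; ring
    rw [e1, e2]
    have f1 := h.sq_bound hS n w hw hw01 k hk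
    have f2 := h.L_bound hS n w hw hw01 k hk
    have W0 : 0 ≤ ∫ ω, w ω ∂μ := integral_nonneg fun ω => (hw01 ω).1
    set W := ∫ ω, w ω ∂μ
    have f3 : (S n - S k) * W ≤ S n * W := by nlinarith [hS0 k]
    have f4 : K * (S n - S k) * W ≤ K * S n * W := by
      rw [mul_assoc, mul_assoc]; exact mul_le_mul_of_nonneg_left f3 h.hK
    have f5 : (s ^ 2 / 2 / η) * ∫ ω, w ω * (M k ω - M n ω) ^ 2 ∂μ ≤ s ^ 2 / 2 * η * W := by
      calc _ ≤ (s ^ 2 / 2 / η) * (η ^ 2 * W) := by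
            refine mul_le_mul_of_nonneg_left ?_ (by positivity)
            exact (f1.trans f3).trans (mul_le_mul_of_nonneg_right hηS W0)
        _ = _ := by field_simp
    have f6 : s ^ 2 / 2 * ∫ ω, w ω * L k ω ∂μ ≤ s ^ 2 / 2 * (∫ ω, w ω * L n ω ∂μ + K * S n * W) :=
      mul_le_mul_of_nonneg_left (by linarith) (by positivity)
    linarith
  have I3 := mul_le_mul_of_nonneg_left I2 (sq_nonneg (r k))
  linarith
end

section
variable {Ω : Type*} [m0 : MeasurableSpace Ω] {μ : Measure Ω} [IsProbabilityMeasure μ]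
  {F : Filtration ℕ m0} {r : ℕ → ℝ} {M L : ℕ → Ω → ℝ} {α b κ K : ℝ}

lemma Sys.manystep (h : Sys μ F r M L α b κ K) {S : ℕ → ℝ} (hS : ∀ n, S n = r n ^ 2 + S (n + 1))
    (hS0 : ∀ n, 0 ≤ S n)
    (n : ℕ) (w : Ω → ℝ) (hw : Measurable[F n] w) (hw01 : ∀ ω, 0 ≤ w ω ∧ w ω ≤ 1)
    (s θ η m : ℝ) (hη : 0 < η) (hηS : S n ≤ η ^ 2)
    (hm : ∀ k, n ≤ k → r k ≤ m) (k : ℕ) (hk : n ≤ k) :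
    ∫ ω, w ω * GG M S b s θ n k ω ∂μ ≤ ∫ ω, w ω * GG M S b s θ n n ω ∂μ
      + (S n - S k) * ∫ ω, w ω * (s ^ 2 / 2 * (2 * η + L n ω + K * S n)
        + 4 * |s| ^ 3 * m + s ^ 4 * m ^ 2) ∂μ := by
  induction k, hk using Nat.le_induction with
  | base => simp
  | succ k hk ih =>
    have := h.onestep hS hS0 n w hw hw01 k hk s θ η m hη hηS (hm k hk)
    have h3 : S n - S (k+1) = (S n - S k) + r k ^ 2 := by linarith [hS k]
    rw [h3, add_mul]; linarith

lemma Sys.limstep (h : Sys μ F r M L α b κ K) {S : ℕ → ℝ} (hS : ∀ n, S n = r n ^ 2 + S (n + 1))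
    (hS0 : ∀ n, 0 ≤ S n) (hSl : Tendsto S atTop (nhds 0)) (Zl : Ω → ℝ)
    (hZ : ∀ᵐ ω ∂μ, Tendsto (fun n => M n ω) atTop (nhds (Zl ω)))
    (n : ℕ) (w : Ω → ℝ) (hw : Measurable[F n] w) (hw01 : ∀ ω, 0 ≤ w ω ∧ w ω ≤ 1)
    (s θ η m : ℝ) (hη : 0 < η) (hηS : S n ≤ η ^ 2)
    (hm : ∀ k, n ≤ k → r k ≤ m) :
    ∫ ω, w ω * cos (θ + s * (M n ω - Zl ω)) ∂μ ≤ ∫ ω, w ω * GG M S b s θ n n ω ∂μ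
      + S n * ∫ ω, w ω * (s ^ 2 / 2 * (2 * η + L n ω + K * S n)
        + 4 * |s| ^ 3 * m + s ^ 4 * m ^ 2) ∂μ := by
  have hw0 : Measurable w := hw.mono (F.le n) le_rfl
  have hwa : ∀ ω, |w ω| ≤ 1 := fun ω => abs_le.2 ⟨by linarith [(hw01 ω).1], (hw01 ω).2⟩
  have T1 : Tendsto (fun k => ∫ ω, w ω * GG M S b s θ n k ω ∂μ) atTop
      (nhds (∫ ω, w ω * cos (θ + s * (M n ω - Zl ω)) ∂μ)) := by
    refine tendsto_integral_of_dominated_convergence (fun _ => 1)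
      (fun k => (hw0.mul (GG_meas M h.M0 S b s θ n k)).aestronglyMeasurable)
      (integrable_const _) (fun k => ae_of_all _ fun ω => ?_) ?_
    · rw [norm_mul]
      exact mul_le_one₀ (hwa ω) (norm_nonneg _) (h.GG_bd hS0 s θ n k ω)
    · filter_upwards [hZ] with ω hω
      refine Tendsto.const_mul _ ?_
      unfold GG
      have t1 : Tendsto (fun k => cos (θ + s * (M n ω - M k ω))) atTop
          (nhds (cos (θ + s * (M n ω - Zl ω)))) :=
        (continuous_cos.tendsto _).comp (((tendsto_const_nhds.sub hω).const_mul s).const_add θ)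
      have t2 : Tendsto (fun k => exp (-(s ^ 2 / 2 * S k * (b * (M n ω * (1 - M n ω)))))) atTop
          (nhds (exp (-(s ^ 2 / 2 * 0 * (b * (M n ω * (1 - M n ω))))))) :=
        (continuous_exp.tendsto _).comp (((hSl.const_mul _).mul_const _).neg)
      simpa using t1.mul t2
  have T2 : Tendsto (fun k => ∫ ω, w ω * GG M S b s θ n n ω ∂μ
      + (S n - S k) * ∫ ω, w ω * (s ^ 2 / 2 * (2 * η + L n ω + K * S n)
        + 4 * |s| ^ 3 * m + s ^ 4 * m ^ 2) ∂μ) atTop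
      (nhds (∫ ω, w ω * GG M S b s θ n n ω ∂μ
      + (S n - 0) * ∫ ω, w ω * (s ^ 2 / 2 * (2 * η + L n ω + K * S n)
        + 4 * |s| ^ 3 * m + s ^ 4 * m ^ 2) ∂μ)) :=
    ((tendsto_const_nhds.sub hSl).mul_const _).const_add _
  rw [sub_zero] at T2
  exact le_of_tendsto_of_tendsto T1 T2 (eventually_atTop.2 ⟨n, fun k hk =>
    h.manystep hS hS0 n w hw hw01 s θ η m hη hηS hm k hk⟩)

lemma Sys.cond_le (h : Sys μ F r M L α b κ K) {S : ℕ → ℝ} (hS : ∀ n, S n = r n ^ 2 + S (n + 1))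
    (hS0 : ∀ n, 0 ≤ S n) (hSl : Tendsto S atTop (nhds 0)) (Zl : Ω → ℝ)
    (hZ : ∀ᵐ ω ∂μ, Tendsto (fun n => M n ω) atTop (nhds (Zl ω)))
    (n : ℕ) (s θ η m : ℝ) (hη : 0 < η) (hηS : S n ≤ η ^ 2)
    (hm : ∀ k, n ≤ k → r k ≤ m) :
    ∀ᵐ ω ∂μ, (μ[fun ω => cos (θ + s * (M n ω - Zl ω)) | F n]) ω ≤
      cos θ * exp (-(s ^ 2 / 2 * S n * (b * (M n ω * (1 - M n ω)))))
      + S n * (s ^ 2 / 2 * (2 * η + L n ω + K * S n) + 4 * |s| ^ 3 * m + s ^ 4 * m ^ 2) := by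
  have hZm : AEMeasurable Zl μ := aemeasurable_of_tendsto_metrizable_ae atTop
    (fun n => (h.M0 n).aemeasurable) hZ
  have ic : Integrable (fun ω => cos (θ + s * (M n ω - Zl ω))) μ := by
    refine Integrable.of_bound ?_ 1 (ae_of_all _ fun ω => abs_cos_le_one _)
    have := h.M0 n
    exact (continuous_cos.measurable.comp_aemeasurable
      (((this.aemeasurable.sub hZm).const_mul s).const_add θ)).aestronglyMeasurable
  set R : Ω → ℝ := fun ω => GG M S b s θ n n ω
      + S n * (s ^ 2 / 2 * (2 * η + L n ω + K * S n) + 4 * |s| ^ 3 * m + s ^ 4 * m ^ 2) with hR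
  have gm : Measurable[F n] (GG M S b s θ n n) := by
    have := h.Mm n
    unfold GG; fun_prop
  have Rm : Measurable[F n] R := by
    have := h.Lm n
    simp only [hR]; fun_prop
  have i1 : Integrable (GG M S b s θ n n) μ :=
    ib' 1 (gm.mono (F.le n) le_rfl) (h.GG_bd hS0 s θ n n)
  have i2 : Integrable (fun ω => (s ^ 2 / 2 * (2 * η + L n ω + K * S n)
      + 4 * |s| ^ 3 * m + s ^ 4 * m ^ 2)) μ := by
    have : Integrable (L n) μ := ib' K (h.L0 n) fun ω => by
      rw [abs_of_nonneg (h.L01 n ω).1]; exact (h.L01 n ω).2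
    fun_prop
  have Ri : Integrable R μ := i1.add (i2.const_mul _)
  have main : μ[fun ω => cos (θ + s * (M n ω - Zl ω)) | F n] ≤ᵐ[μ.trim (F.le n)] R := by
    refine ae_le_of_forall_setIntegral_le
      (integrable_condExp.trim (F.le n) stronglyMeasurable_condExp)
      (Ri.trim (F.le n) Rm.stronglyMeasurable) fun A hA _ => ?_
    rw [← setIntegral_trim (F.le n) stronglyMeasurable_condExp hA,
      ← setIntegral_trim (F.le n) Rm.stronglyMeasurable hA, setIntegral_condExp (F.le n) ic hA]
    have hA0 := F.le n A hA
    have q := h.limstep hS hS0 hSl Zl hZ n (A.indicator fun _ => 1)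
      (measurable_const.indicator hA) (fun ω => by
        by_cases hω : ω ∈ A <;> simp [hω]) s θ η m hη hηS hm
    have conv : ∀ g : Ω → ℝ, ∫ ω, A.indicator (fun _ => (1:ℝ)) ω * g ω ∂μ = ∫ ω in A, g ω ∂μ := by
      intro g
      rw [← integral_indicator hA0]
      congr 1; ext ω
      by_cases hω : ω ∈ A <;> simp [hω]
    rw [conv, conv, conv] at q
    refine q.trans (le_of_eq ?_)
    simp only [hR]
    rw [integral_add i1.integrableOn (i2.const_mul _).integrableOn, integral_const_mul]
  filter_upwards [ae_le_of_ae_le_trim main] with ω hω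
  refine hω.trans (le_of_eq ?_)
  simp [hR, GG]

lemma Sys.cond_abs (h : Sys μ F r M L α b κ K) {S : ℕ → ℝ} (hS : ∀ n, S n = r n ^ 2 + S (n + 1))
    (hS0 : ∀ n, 0 ≤ S n) (hSl : Tendsto S atTop (nhds 0)) (Zl : Ω → ℝ)
    (hZ : ∀ᵐ ω ∂μ, Tendsto (fun n => M n ω) atTop (nhds (Zl ω)))
    (n : ℕ) (s θ η m : ℝ) (hη : 0 < η) (hηS : S n ≤ η ^ 2)
    (hm : ∀ k, n ≤ k → r k ≤ m) :
    ∀ᵐ ω ∂μ, |(μ[fun ω => cos (θ + s * (M n ω - Zl ω)) | F n]) ω -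
      cos θ * exp (-(s ^ 2 / 2 * S n * (b * (M n ω * (1 - M n ω)))))| ≤
      S n * (s ^ 2 / 2 * (2 * η + L n ω + K * S n) + 4 * |s| ^ 3 * m + s ^ 4 * m ^ 2) := by
  have h1 := h.cond_le hS hS0 hSl Zl hZ n s θ η m hη hηS hm
  have h2 := h.cond_le hS hS0 hSl Zl hZ n s (θ + π) η m hη hηS hm
  have e : (fun ω => cos (θ + π + s * (M n ω - Zl ω))) = -(fun ω => cos (θ + s * (M n ω - Zl ω))) := by
    ext ω
    rw [show θ + π + s * (M n ω - Zl ω) = θ + s * (M n ω - Zl ω) + π by ring, cos_add_pi]; rfl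
  rw [e, cos_add_pi] at h2
  have h3 := condExp_neg (μ := μ) (fun ω => cos (θ + s * (M n ω - Zl ω))) (F n)
  filter_upwards [h1, h2, h3] with ω a1 a2 a3
  rw [a3, Pi.neg_apply] at a2
  rw [abs_le]; constructor <;> linarith

lemma Sys.L_tendsto (h : Sys μ F r M L α b κ K) {S : ℕ → ℝ} (hS : ∀ n, S n = r n ^ 2 + S (n + 1))
    (hS0 : ∀ n, 0 ≤ S n) (hSl : Tendsto S atTop (nhds 0)) (hns : ¬ Summable r) :
    ∀ᵐ ω ∂μ, Tendsto (fun n => L n ω) atTop (nhds 0) := by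
  have hK := h.hK
  have Li : ∀ n, Integrable (L n) μ := fun n => ib' K (h.L0 n) fun ω => by
      rw [abs_of_nonneg (h.L01 n ω).1]; exact (h.L01 n ω).2
  have hSle : ∀ n, S n ≤ S 0 := fun n => by
    induction n with
    | zero => exact le_rfl
    | succ n ih => have := hS n; nlinarith [sq_nonneg (r n)]
  set f : ℕ → Ω → ℝ := fun n ω => -(L n ω + K * S n) with hf
  have fi : ∀ n, Integrable (f n) μ := fun n => ((Li n).add (integrable_const _)).neg
  have sub : Submartingale f F μ := by
    refine submartingale_of_setIntegral_le_succ (fun n => ?_) fi fun n A hA => ?_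
    · have := h.Lm n
      have : Measurable[F n] (f n) := by simp only [hf]; fun_prop
      exact this.stronglyMeasurable
    · have hA0 := F.le n A hA
      have conv : ∀ g : Ω → ℝ, ∫ ω, A.indicator (fun _ => (1:ℝ)) ω * g ω ∂μ = ∫ ω in A, g ω ∂μ := by
        intro g
        rw [← integral_indicator hA0]
        congr 1; ext ω
        by_cases hω : ω ∈ A <;> simp [hω]
      have q := h.Lrec n (A.indicator fun _ => 1) 1 (measurable_const.indicator hA) (fun ω => by
        by_cases hω : ω ∈ A <;> simp [hω])
      rw [conv, conv] at q
      simp only [hf, integral_neg]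
      refine neg_le_neg ?_
      rw [integral_add (Li _).integrableOn (integrable_const _)]
      have i2 : Integrable (fun ω => (1 - α * r n) * L n ω + K * r n ^ 2) μ :=
        ((Li n).const_mul _).add (integrable_const _)
      refine (add_le_add_left q _).trans ?_
      rw [← integral_add i2.integrableOn (integrable_const _)]
      refine setIntegral_mono (i2.add (integrable_const _)).integrableOn
        ((Li n).add (integrable_const _)).integrableOn fun ω => ?_
      have : 0 ≤ α * r n * L n ω := mul_nonneg (mul_nonneg h.hα.1.le (h.hr n).1) (h.L01 n ω).1
      have := hS n
      rw [this]; nlinarith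
  have bd : ∀ n, eLpNorm (f n) 1 μ ≤ ((K + K * S 0).toNNReal : ENNReal) := fun n => by
    have := eLpNorm_le_of_ae_bound (p := 1) (μ := μ) (f := f n) (C := K + K * S 0)
      (ae_of_all _ fun ω => by
        have := h.L01 n ω
        have := hS0 n; have := hSle n
        simp only [hf]
        rw [norm_neg, Real.norm_eq_abs, abs_of_nonneg (by nlinarith [mul_nonneg hK (hS0 n)])]
        nlinarith)
    simpa [ENNReal.ofReal] using this
  have conv := sub.exists_ae_tendsto_of_bdd bd
  -- expectations
  set e : ℕ → ℝ := fun n => ∫ ω, L n ω ∂μ with he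
  have e0 : ∀ n, 0 ≤ e n := fun n => integral_nonneg fun ω => (h.L01 n ω).1
  have erec : ∀ n, e (n + 1) ≤ (1 - α * r n) * e n + K * r n ^ 2 := fun n => by
    have q := h.Lrec n (fun _ => 1) 1 measurable_const (fun ω => by norm_num)
    simp only [one_mul] at q
    rw [integral_add ((Li n).const_mul _) (integrable_const _), integral_const_mul] at q
    simpa using q
  have esum : ∀ n, α * ∑ k ∈ Finset.range n, r k * e k ≤ e 0 + K * S 0 - e n - K * S n := fun n => by
    induction n with
    | zero => simp
    | succ n ih =>
      rw [Finset.sum_range_succ]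
      have := erec n
      have := hS n
      have : K * S n = K * r n ^ 2 + K * S (n + 1) := by rw [this]; ring
      linarith
  have esm : Summable fun k => r k * e k := by
    refine summable_of_sum_range_le (c := (e 0 + K * S 0) / α)
      (fun k => mul_nonneg (h.hr k).1 (e0 k)) fun n => ?_
    rw [le_div_iff₀ h.hα.1]
    have := esum n; have := e0 n; have := mul_nonneg hK (hS0 n)
    linarith
  -- limit
  have conv2 : ∀ᵐ ω ∂μ, ∃ c, Tendsto (fun n => L n ω) atTop (nhds c) := by
    filter_upwards [conv] with ω ⟨c, hc⟩
    refine ⟨-c - K * 0, ?_⟩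
    have := hc.neg.sub (hSl.const_mul K)
    refine this.congr fun n => ?_
    simp only [hf]; ring
  obtain ⟨g, hgm, hg⟩ := measurable_limit_of_tendsto_metrizable_ae
    (fun n => (h.L0 n).aemeasurable) conv2
  have elim : Tendsto e atTop (nhds (∫ ω, g ω ∂μ)) := by
    refine tendsto_integral_of_dominated_convergence (fun _ => K)
      (fun k => (h.L0 k).aestronglyMeasurable) (integrable_const _)
      (fun k => ae_of_all _ fun ω => ?_) hg
    rw [Real.norm_eq_abs, abs_of_nonneg (h.L01 k ω).1]; exact (h.L01 k ω).2
  have g0 : 0 ≤ᵐ[μ] g := by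
    filter_upwards [hg] with ω hω
    exact ge_of_tendsto' hω fun n => (h.L01 n ω).1
  have gK : ∀ᵐ ω ∂μ, ‖g ω‖ ≤ K := by
    filter_upwards [hg, g0] with ω hω h0
    rw [Real.norm_eq_abs, abs_of_nonneg h0]
    exact le_of_tendsto' hω fun n => (h.L01 n ω).2
  have gi : Integrable g μ := Integrable.of_bound hgm.aestronglyMeasurable K gK
  have gz : ∫ ω, g ω ∂μ = 0 := by
    by_contra hne
    have pos : 0 < ∫ ω, g ω ∂μ := lt_of_le_of_ne (integral_nonneg_of_ae g0) (Ne.symm hne)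
    set l := ∫ ω, g ω ∂μ
    apply hns
    have ev : ∀ᶠ n in atTop, l / 2 < e n := elim.eventually (lt_mem_nhds (by linarith))
    obtain ⟨n0, hn0⟩ := eventually_atTop.1 ev
    have s1 := esm.mul_left (2 / l)
    refine (summable_nat_add_iff n0).1 ?_
    refine Summable.of_nonneg_of_le (fun k => (h.hr _).1) (fun k => ?_) ((summable_nat_add_iff n0).2 s1)
    have := hn0 (k + n0) (by omega)
    have : 1 ≤ 2 / l * e (k + n0) := by
      rw [div_mul_eq_mul_div, le_div_iff₀ pos]; linarith
    have := mul_le_mul_of_nonneg_left this (h.hr (k + n0)).1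
    linarith
  have gae := (integral_eq_zero_iff_of_nonneg_ae g0 gi).1 gz
  filter_upwards [hg, gae] with ω h1 h2
  rw [h2] at h1
  simpa using h1
end

lemma nonneg_of_step {d : ℕ → ℝ} (hd : Tendsto d atTop (nhds 0)) (n0 : ℕ)
    (h : ∀ n, n0 ≤ n → d (n + 1) ≤ d n) (n : ℕ) (hn : n0 ≤ n) : 0 ≤ d n := by
  have : ∀ k, n ≤ k → d k ≤ d n := fun k hk => by
    induction k, hk using Nat.le_induction with
    | base => exact le_rfl
    | succ k hk ih => exact (h k (hn.trans hk)).trans ih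
  exact le_of_tendsto hd (eventually_atTop.2 ⟨n, this⟩)

lemma tail_ratio {S T x : ℕ → ℝ} {A : ℝ} (hS : ∀ n, S n = x n + S (n + 1))
    (hSl : Tendsto S atTop (nhds 0)) (hTl : Tendsto T atTop (nhds 0))
    (hT : ∀ᶠ n in atTop, 0 < T n ∧ T (n + 1) < T n)
    (hx : Tendsto (fun n => x n / (T n - T (n + 1))) atTop (nhds A)) :
    Tendsto (fun n => S n / T n) atTop (nhds A) := by
  rw [tendsto_order]
  constructor
  · intro a ha
    obtain ⟨a', h1, h2⟩ := exists_between ha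
    obtain ⟨n0, hn0⟩ := eventually_atTop.1 ((hx.eventually (lt_mem_nhds h2)).and hT)
    have := nonneg_of_step (d := fun n => S n - a' * T n)
      (by simpa using hSl.sub (hTl.const_mul a')) n0 (fun n hn => by
        obtain ⟨q1, q2, q3⟩ := hn0 n hn
        rw [lt_div_iff₀ (by linarith)] at q1
        have := hS n
        nlinarith)
    filter_upwards [eventually_ge_atTop n0] with n hn
    have q := this n hn
    have p := (hn0 n hn).2.1
    rw [lt_div_iff₀ p]
    nlinarith
  · intro a ha
    obtain ⟨a', h1, h2⟩ := exists_between ha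
    obtain ⟨n0, hn0⟩ := eventually_atTop.1 ((hx.eventually (gt_mem_nhds h1)).and hT)
    have := nonneg_of_step (d := fun n => a' * T n - S n)
      (by simpa using (hTl.const_mul a').sub hSl) n0 (fun n hn => by
        obtain ⟨q1, q2, q3⟩ := hn0 n hn
        rw [div_lt_iff₀ (by linarith)] at q1
        have := hS n
        nlinarith)
    filter_upwards [eventually_ge_atTop n0] with n hn
    have q := this n hn
    have p := (hn0 n hn).2.1
    rw [div_lt_iff₀ p]
    nlinarith

lemma rpow_diff (β : ℝ) :
    Tendsto (fun n : ℕ => (n : ℝ) ^ (β + 1) * ((n : ℝ) ^ (-β) - ((n + 1 : ℕ) : ℝ) ^ (-β)))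
      atTop (nhds β) := by
  have hd : HasDerivAt (fun x : ℝ => (1 + x) ^ (-β)) (-β) 0 := by
    have h1 : HasDerivAt (fun x : ℝ => 1 + x) 1 0 := (hasDerivAt_id 0).const_add 1
    have := h1.rpow_const (p := -β) (Or.inl (by norm_num))
    simpa using this
  have hs := hd.tendsto_slope_zero
  have hn : Tendsto (fun n : ℕ => ((n : ℝ))⁻¹) atTop (nhdsWithin 0 {0}ᶜ) := by
    refine tendsto_nhdsWithin_iff.2 ⟨tendsto_inv_atTop_nhds_zero_nat, ?_⟩
    filter_upwards [eventually_gt_atTop 0] with n hn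
    simp; omega
  have := (hs.comp hn).neg
  rw [neg_neg] at this
  refine this.congr' ?_
  filter_upwards [eventually_gt_atTop 0] with n hn
  have hn' : (0:ℝ) < n := by exact_mod_cast hn
  simp only [Function.comp, zero_add, add_zero, one_rpow, inv_inv, smul_eq_mul]
  have e1 : ((n + 1 : ℕ) : ℝ) = n * (1 + (n:ℝ)⁻¹) := by push_cast; field_simp
  rw [e1, mul_rpow hn'.le (by positivity), rpow_add hn', rpow_neg hn'.le, rpow_one]
  have : (n:ℝ) ^ β ≠ 0 := (rpow_pos_of_pos hn' β).ne'
  field_simp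
  ring

lemma tail_asymp (r : ℕ → ℝ) (hr : ∀ n, 0 ≤ r n) (c γ : ℝ) (hc : 0 < c) (hγ : 1/2 < γ ∧ γ ≤ 1)
    (hlim : Tendsto (fun n : ℕ => (n : ℝ) ^ γ * r n) atTop (nhds c)) :
    ∃ S : ℕ → ℝ, (∀ n, S n = r n ^ 2 + S (n + 1)) ∧ (∀ n, 0 ≤ S n) ∧ Tendsto S atTop (nhds 0) ∧
      Tendsto (fun n : ℕ => ((n : ℝ) ^ (γ - 1/2)) ^ 2 * S n) atTop (nhds (c ^ 2 / (2 * γ - 1))) ∧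
      (¬ Summable r) ∧
      (∃ n0 : ℕ, ∀ n, n0 ≤ n → ∀ k, n ≤ k → r k ≤ 2 * c * (n : ℝ) ^ (-γ)) := by
  obtain ⟨n0, hn0⟩ := eventually_atTop.1
    ((hlim.eventually (gt_mem_nhds (show c < 2 * c by linarith))).and
      ((hlim.eventually (lt_mem_nhds (show c / 2 < c by linarith))).and (eventually_gt_atTop 0)))
  have up : ∀ k, n0 ≤ k → r k ≤ 2 * c * (k : ℝ) ^ (-γ) := fun k hk => by
    obtain ⟨h1, h2, h3⟩ := hn0 k hk
    have hk' : (0:ℝ) < k := by exact_mod_cast h3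
    rw [rpow_neg hk'.le, ← div_eq_mul_inv, le_div_iff₀ (rpow_pos_of_pos hk' γ)]
    linarith
  have sm : Summable fun k => r k ^ 2 := by
    refine (summable_nat_add_iff n0).1 ?_
    have : Summable fun k : ℕ => (2 * c) ^ 2 * (k : ℝ) ^ (-(2 * γ)) :=
      (Real.summable_nat_rpow.2 (by linarith)).mul_left _
    refine Summable.of_nonneg_of_le (fun k => sq_nonneg _) (fun k => ?_)
      ((summable_nat_add_iff n0).2 this)
    refine (pow_le_pow_left₀ (hr _) (up (k + n0) (by omega)) 2).trans (le_of_eq ?_)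
    rw [mul_pow, ← rpow_natCast (_ ^ (-γ)), ← rpow_mul (by positivity)]
    congr 2; push_cast; ring
  set S : ℕ → ℝ := fun n => ∑' k, r (k + n) ^ 2 with hSd
  have hS : ∀ n, S n = r n ^ 2 + S (n + 1) := fun n => by
    simp only [hSd]
    rw [((summable_nat_add_iff n).2 sm).tsum_eq_zero_add]
    simp [add_assoc, add_comm 1 n]
  have hSl : Tendsto S atTop (nhds 0) := tendsto_sum_nat_add fun k => r k ^ 2
  have hb : 0 < 2 * γ - 1 := by linarith
  refine ⟨S, hS, fun n => tsum_nonneg fun k => sq_nonneg _, hSl, ?_, ?_, n0, fun n hn k hk => ?_⟩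
  · set β := 2 * γ - 1 with hβ
    have key := tail_ratio (S := S) (T := fun n : ℕ => (n : ℝ) ^ (-β)) (x := fun n => r n ^ 2)
      (A := c ^ 2 / β) hS hSl ((tendsto_rpow_neg_atTop hb).comp tendsto_natCast_atTop_atTop)
      (by
        filter_upwards [eventually_gt_atTop 0] with n hn
        have hn' : (0:ℝ) < n := by exact_mod_cast hn
        refine ⟨rpow_pos_of_pos hn' _, ?_⟩
        exact rpow_lt_rpow_of_neg hn' (by push_cast; linarith) (by linarith))
      (by
        have := (hlim.pow 2).div (rpow_diff β) hb.ne'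
        refine this.congr' ?_
        filter_upwards [eventually_gt_atTop 0] with n hn
        have hn' : (0:ℝ) < n := by exact_mod_cast hn
        have : (n:ℝ) ^ (β + 1) = ((n:ℝ) ^ γ) ^ 2 := by
          rw [← rpow_natCast (_ ^ γ), ← rpow_mul hn'.le]; congr 1; push_cast; rw [hβ]; ring
        rw [Pi.div_apply, this, mul_pow, mul_div_mul_left]
        exact pow_ne_zero _ (rpow_pos_of_pos hn' γ).ne')
    refine key.congr' ?_
    filter_upwards [eventually_gt_atTop 0] with n hn
    have hn' : (0:ℝ) < n := by exact_mod_cast hn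
    rw [rpow_neg hn'.le, div_inv_eq_mul, mul_comm]
    congr 1
    rw [← rpow_natCast (_ ^ (γ - 1/2)), ← rpow_mul hn'.le]; congr 1; push_cast; rw [hβ]; ring
  · intro hs
    apply Real.not_summable_one_div_natCast
    refine (summable_nat_add_iff n0).1 ?_
    refine Summable.of_nonneg_of_le (fun k => by positivity) (fun k => ?_)
      ((summable_nat_add_iff n0).2 (hs.mul_left (2 / c)))
    obtain ⟨h1, h2, h3⟩ := hn0 (k + n0) (by omega)
    have hk' : (1:ℝ) ≤ ((k + n0 : ℕ) : ℝ) := by exact_mod_cast h3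
    have h4 : ((k + n0 : ℕ) : ℝ) ^ γ ≤ ((k + n0 : ℕ) : ℝ) := by
      simpa using rpow_le_rpow_of_exponent_le hk' hγ.2
    rw [div_le_iff₀ (by linarith)]
    have h5 := mul_le_mul_of_nonneg_right h4 (hr (k + n0))
    have : 2 / c * r (k + n0) * ((k + n0 : ℕ) : ℝ) = (((k + n0 : ℕ) : ℝ) * r (k + n0)) / (c / 2) := by
      field_simp
    rw [this, le_div_iff₀ (by linarith)]
    linarith
  · refine (up k (hn.trans hk)).trans ?_
    have h3 := (hn0 n hn).2.2
    have hn' : (0:ℝ) < n := by exact_mod_cast h3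
    refine mul_le_mul_of_nonneg_left ?_ (by linarith)
    exact rpow_le_rpow_of_nonpos hn' (by exact_mod_cast hk) (by linarith)

lemma exists_cond {Ω : Type*} [m0 : MeasurableSpace Ω] (μ : Measure Ω) [IsProbabilityMeasure μ]
    (m : MeasurableSpace Ω) (hm : m ≤ m0) (Y : Ω → ℝ) (hY : AEMeasurable Y μ) :
    ∃ κ : Ω → ProbabilityMeasure ℝ, ∀ g : ℝ → ℝ, Continuous g → (∃ C, ∀ x, |g x| ≤ C) →
      μ[fun ω => g (Y ω) | m] =ᵐ[μ] fun ω => ∫ x, g x ∂(κ ω : Measure ℝ) := by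
  refine ⟨fun ω => ⟨@ProbabilityTheory.condDistrib Ω Ω ℝ _ _ _ m0 m Y id μ _ ω, inferInstance⟩,
    fun g hg ⟨C, hC⟩ => ?_⟩
  have := @ProbabilityTheory.condExp_ae_eq_integral_condDistrib Ω Ω ℝ ℝ _ _ _ _ m0 μ _ id Y m _ _
    (measurable_id'' hm) hY g hg.stronglyMeasurable
    (Integrable.of_bound (hg.measurable.comp_aemeasurable hY).aestronglyMeasurable C
      (ae_of_all _ fun ω => hC _))
  rw [MeasurableSpace.comap_id] at this
  exact this

lemma cont_cos_int (ν : Measure ℝ) [IsProbabilityMeasure ν] (θ : ℝ) :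
    Continuous fun t : ℝ => ∫ x, cos (θ + t * x) ∂ν := by
  refine continuous_of_dominated (bound := fun _ => 1) (fun t => ?_) (fun t => ?_)
    (integrable_const _) ?_
  · exact (by fun_prop : Measurable fun x : ℝ => cos (θ + t * x)).aestronglyMeasurable
  · exact ae_of_all _ fun x => abs_cos_le_one _
  · exact ae_of_all _ fun x => by fun_prop

lemma levy_cos (ν : ℕ → ProbabilityMeasure ℝ) (v : ℝ) (hv : 0 ≤ v)
    (h : ∀ θ, (θ = 0 ∨ θ = -(π / 2)) → ∀ t : ℝ,
      Tendsto (fun n => ∫ x, cos (θ + t * x) ∂(ν n : Measure ℝ)) atTop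
      (nhds (cos θ * exp (-(t ^ 2 / 2 * v)))))
    (f : ℝ → ℝ) (hf : Continuous f) (hfb : ∃ C, ∀ x, |f x| ≤ C) :
    Tendsto (fun n => ∫ x, f x ∂(ν n : Measure ℝ)) atTop
      (nhds (∫ x, f x ∂(ProbabilityTheory.gaussianReal 0 v.toNNReal))) := by
  let ν' : ProbabilityMeasure ℝ := ⟨ProbabilityTheory.gaussianReal 0 v.toNNReal, inferInstance⟩
  have T : Tendsto ν atTop (nhds ν') := by
    refine ProbabilityMeasure.tendsto_iff_tendsto_charFun.2 fun t => ?_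
    have e : ∀ n, charFun (ν n : Measure ℝ) t
        = ((∫ x, cos (0 + t * x) ∂(ν n : Measure ℝ) : ℝ) : ℂ)
          + ((∫ x, cos (-(π / 2) + t * x) ∂(ν n : Measure ℝ) : ℝ) : ℂ) * Complex.I := by
      intro n
      have i1 : ∀ θ, Integrable (fun x : ℝ => ((cos (θ + t * x) : ℝ) : ℂ)) (ν n : Measure ℝ) := by
        intro θ
        refine Integrable.ofReal ?_
        exact Integrable.of_bound
          (by fun_prop : Measurable fun x : ℝ => cos (θ + t * x)).aestronglyMeasurable 1
          (ae_of_all _ fun x => abs_cos_le_one _)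
      rw [charFun_apply_real, ← integral_complex_ofReal, ← integral_complex_ofReal, ← integral_mul_const,
        ← integral_add (i1 _) ((i1 _).mul_const _)]
      congr 1; ext x
      have : cos (-(π / 2) + t * x) = sin (t * x) := by
        rw [neg_add_eq_sub, cos_sub_pi_div_two]
      rw [this, zero_add]
      rw [Complex.ofReal_cos, Complex.ofReal_sin, ← Complex.exp_mul_I]
      push_cast; rfl
    have lim : charFun (ν' : Measure ℝ) t = ((cos 0 * exp (-(t ^ 2 / 2 * v)) : ℝ) : ℂ)
        + ((cos (-(π / 2)) * exp (-(t ^ 2 / 2 * v)) : ℝ) : ℂ) * Complex.I := by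
      change charFun (ProbabilityTheory.gaussianReal 0 v.toNNReal) t = _
      rw [ProbabilityTheory.charFun_gaussianReal]
      rw [cos_neg, cos_pi_div_two, cos_zero]
      push_cast [Real.coe_toNNReal v hv]
      simp
      ring_nf
    simp_rw [e]
    rw [lim]
    have c1 := (Complex.continuous_ofReal.tendsto _).comp (h 0 (Or.inl rfl) t)
    have c2 := (Complex.continuous_ofReal.tendsto _).comp (h _ (Or.inr rfl) t)
    exact c1.add (c2.mul_const _)
  obtain ⟨C, hC⟩ := hfb
  have := ProbabilityMeasure.tendsto_iff_forall_integral_tendsto.1 T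
    (BoundedContinuousFunction.ofNormedAddCommGroup f hf C hC)
  exact this

section
variable {Ω : Type*} [m0 : MeasurableSpace Ω] {μ : Measure Ω} [IsProbabilityMeasure μ]
  {F : Filtration ℕ m0} {r : ℕ → ℝ} {M L : ℕ → Ω → ℝ} {α b κ K : ℝ}

theorem Sys.clt (h : Sys μ F r M L α b κ K) (c γ : ℝ) (hc : 0 < c) (hγ : 1/2 < γ ∧ γ ≤ 1)
    (hlim : Tendsto (fun n : ℕ => (n : ℝ) ^ γ * r n) atTop (nhds c)) (Zl : Ω → ℝ)
    (hZ : ∀ᵐ ω ∂μ, Tendsto (fun n => M n ω) atTop (nhds (Zl ω)))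
    (f : ℝ → ℝ) (hf : Continuous f) (hfb : ∃ C, ∀ x, |f x| ≤ C) :
    ∀ᵐ ω ∂μ, Tendsto
        (fun n : ℕ => (μ[(fun ω' => f ((n : ℝ) ^ (γ - 1/2) * (M n ω' - Zl ω'))) | F n]) ω)
        atTop
        (nhds (∫ x, f x ∂(ProbabilityTheory.gaussianReal 0
          (Real.toNNReal (c ^ 2 / (2 * γ - 1) * (b * (Zl ω * (1 - Zl ω)))))))) := by
  obtain ⟨S, hS, hS0, hSl, hSa, hns, n0, hn0⟩ :=
    tail_asymp r (fun n => (h.hr n).1) c γ hc hγ hlim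
  have hZm : AEMeasurable Zl μ := aemeasurable_of_tendsto_metrizable_ae atTop
    (fun n => (h.M0 n).aemeasurable) hZ
  have hL := h.L_tendsto hS hS0 hSl hns
  set a : ℕ → ℝ := fun n => (n : ℝ) ^ (γ - 1/2) with ha
  have ex : ∀ n : ℕ, ∃ κ : Ω → ProbabilityMeasure ℝ, ∀ g : ℝ → ℝ, Continuous g →
      (∃ C, ∀ x, |g x| ≤ C) →
      μ[fun ω => g (a n * (M n ω - Zl ω)) | F n] =ᵐ[μ] fun ω => ∫ x, g x ∂(κ ω : Measure ℝ) :=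
    fun n => exists_cond μ (F n) (F.le n) _ (((h.M0 n).aemeasurable.sub hZm).const_mul (a n))
  choose ν hν using ex
  set η : ℕ → ℝ := fun n => √(S n) + 1 / ((n : ℝ) + 1) with hη
  have hη0 : ∀ n, 0 < η n := fun n => by simp only [hη]; positivity
  have hηS : ∀ n, S n ≤ η n ^ 2 := fun n => by
    calc S n = √(S n) ^ 2 := (sq_sqrt (hS0 n)).symm
      _ ≤ η n ^ 2 := by
        refine pow_le_pow_left₀ (sqrt_nonneg _) ?_ 2
        simp only [hη]
        have : 0 ≤ 1 / ((n : ℝ) + 1) := by positivity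
        linarith
  set mm : ℕ → ℝ := fun n => 2 * c * (n : ℝ) ^ (-γ) with hmm
  -- error
  set Er : ℝ → ℕ → Ω → ℝ := fun t n ω => S n * ((t * a n) ^ 2 / 2 * (2 * η n + L n ω + K * S n)
    + 4 * |t * a n| ^ 3 * mm n + (t * a n) ^ 4 * mm n ^ 2) with hEr
  have key : ∀ θ : ℝ, ∀ᵐ ω ∂μ, ∀ n, n0 ≤ n → ∀ t : ℝ,
      |∫ x, cos (θ + t * x) ∂(ν n ω : Measure ℝ) -
        cos θ * exp (-((t * a n) ^ 2 / 2 * S n * (b * (M n ω * (1 - M n ω)))))| ≤ Er t n ω := by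
    intro θ
    have q : ∀ᵐ ω ∂μ, ∀ n, n0 ≤ n → ∀ t : ℚ,
      |∫ x, cos (θ + (t : ℝ) * x) ∂(ν n ω : Measure ℝ) -
        cos θ * exp (-(((t : ℝ) * a n) ^ 2 / 2 * S n * (b * (M n ω * (1 - M n ω)))))|
          ≤ Er t n ω := by
      rw [ae_all_iff]; intro n
      by_cases hn : n0 ≤ n
      swap
      · exact ae_of_all _ fun ω h' => absurd h' hn
      have : ∀ t : ℚ, ∀ᵐ ω ∂μ, |∫ x, cos (θ + (t : ℝ) * x) ∂(ν n ω : Measure ℝ) -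
        cos θ * exp (-(((t : ℝ) * a n) ^ 2 / 2 * S n * (b * (M n ω * (1 - M n ω)))))|
          ≤ Er t n ω := by
        intro t
        have q1 := h.cond_abs hS hS0 hSl Zl hZ n (t * a n) θ (η n) (mm n) (hη0 n) (hηS n)
          (hn0 n hn)
        have q2 := hν n (fun x => cos (θ + (t : ℝ) * x)) (by fun_prop)
          ⟨1, fun x => abs_cos_le_one _⟩
        have e : (fun ω => cos (θ + (t : ℝ) * (a n * (M n ω - Zl ω))))
          = fun ω => cos (θ + (t : ℝ) * a n * (M n ω - Zl ω)) := by ext ω; rw [mul_assoc]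
        rw [e] at q2
        filter_upwards [q1, q2] with ω w1 w2
        rw [w2] at w1
        exact w1
      filter_upwards [ae_all_iff.2 this] with ω hω _ t
      exact hω t
    filter_upwards [q] with ω hω n hn
    have cl : IsClosed {t : ℝ | |∫ x, cos (θ + t * x) ∂(ν n ω : Measure ℝ) -
        cos θ * exp (-((t * a n) ^ 2 / 2 * S n * (b * (M n ω * (1 - M n ω)))))| ≤ Er t n ω} := by
      refine isClosed_le ?_ ?_
      · have := cont_cos_int (ν n ω : Measure ℝ) θ
        fun_prop
      · simp only [hEr]; fun_prop
    have := cl.closure_subset_iff.2 (show Set.range ((↑) : ℚ → ℝ) ⊆ _ from by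
      rintro _ ⟨t, rfl⟩; exact hω n hn t)
    rw [Rat.isDenseEmbedding_coe_real.dense.closure_range] at this
    exact fun t => this (Set.mem_univ t)
  have hηl : Tendsto η atTop (nhds 0) := by
    have h1 : Tendsto (fun n => √(S n)) atTop (nhds (√0)) := (continuous_sqrt.tendsto 0).comp hSl
    have := h1.add (tendsto_one_div_add_atTop_nhds_zero_nat (𝕜 := ℝ))
    simpa [hη] using this
  have ham : Tendsto (fun n => a n * mm n) atTop (nhds 0) := by
    have h1 : Tendsto (fun n : ℕ => (n : ℝ) ^ (-(1/2 : ℝ))) atTop (nhds 0) :=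
      (tendsto_rpow_neg_atTop (by norm_num)).comp tendsto_natCast_atTop_atTop
    have h2 := h1.const_mul (2 * c)
    rw [mul_zero] at h2
    refine h2.congr' ?_
    filter_upwards [eventually_gt_atTop 0] with n hn
    have hn' : (0:ℝ) < n := by exact_mod_cast hn
    simp only [ha, hmm]
    rw [mul_left_comm, ← rpow_add hn']
    congr 2; ring
  have ha0 : ∀ n, 0 ≤ a n := fun n => by simp only [ha]; positivity
  filter_upwards [key 0, key (-(π / 2)), hL, hZ, ae_all_iff.2 fun n => hν n f hf hfb]
    with ω k1 k2 hLω hZω hfω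
  refine Tendsto.congr (fun n => (hfω n).symm) ?_
  have v0 : 0 ≤ c ^ 2 / (2 * γ - 1) * (b * (Zl ω * (1 - Zl ω))) := by
    have z0 : 0 ≤ Zl ω := ge_of_tendsto' hZω fun n => (h.M01 n ω).1
    have z1 : Zl ω ≤ 1 := le_of_tendsto' hZω fun n => (h.M01 n ω).2
    have : 0 < 2 * γ - 1 := by linarith [hγ.1]
    have := h.hb.1
    have : 0 ≤ 1 - Zl ω := by linarith
    positivity
  refine levy_cos (fun n => ν n ω) _ v0 (fun θ hθ t => ?_) f hf hfb
  have kθ : ∀ n, n0 ≤ n →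
      |∫ x, cos (θ + t * x) ∂(ν n ω : Measure ℝ) -
        cos θ * exp (-((t * a n) ^ 2 / 2 * S n * (b * (M n ω * (1 - M n ω)))))| ≤ Er t n ω := by
    rcases hθ with rfl | rfl
    · exact fun n hn => k1 n hn t
    · exact fun n hn => k2 n hn t
  have El : Tendsto (fun n => Er t n ω) atTop (nhds 0) := by
    have e : (fun n => Er t n ω) = fun n => (a n ^ 2 * S n) * (t ^ 2 / 2 * (2 * η n + L n ω + K * S n)
        + 4 * |t| ^ 3 * (a n * mm n) + t ^ 4 * (a n * mm n) ^ 2) := by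
      ext n
      simp only [hEr]
      rw [abs_mul, abs_of_nonneg (ha0 n)]; ring
    rw [e]
    have hSa' : Tendsto (fun n => a n ^ 2 * S n) atTop (nhds (c ^ 2 / (2 * γ - 1))) := hSa
    have := hSa'.mul (((((hηl.const_mul 2).add hLω).add (hSl.const_mul K)).const_mul (t ^ 2 / 2)).add
      (ham.const_mul (4 * |t| ^ 3)) |>.add ((ham.pow 2).const_mul (t ^ 4)))
    simpa using this
  have d1 : Tendsto (fun n => ∫ x, cos (θ + t * x) ∂(ν n ω : Measure ℝ) -
        cos θ * exp (-((t * a n) ^ 2 / 2 * S n * (b * (M n ω * (1 - M n ω)))))) atTop (nhds 0) :=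
    squeeze_zero_norm' (eventually_atTop.2 ⟨n0, kθ⟩) El
  have d2 : Tendsto (fun n => cos θ * exp (-((t * a n) ^ 2 / 2 * S n * (b * (M n ω * (1 - M n ω))))))
      atTop (nhds (cos θ * exp (-(t ^ 2 / 2 * (c ^ 2 / (2 * γ - 1) * (b * (Zl ω * (1 - Zl ω)))))))) := by
    refine Tendsto.const_mul _ ((continuous_exp.tendsto _).comp (Tendsto.neg ?_))
    have := (hSa.mul ((hZω.mul (hZω.const_sub 1)).const_mul b)).const_mul (t ^ 2 / 2)
    refine this.congr fun n => ?_
    simp only [ha]; ring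
  have := d1.add d2
  rw [zero_add] at this
  exact this.congr fun n => by ring
end
lemma int_cond {Ω : Type*} {m : MeasurableSpace Ω} [m0 : MeasurableSpace Ω] {μ : Measure Ω} [IsProbabilityMeasure μ]
    (hm : m ≤ m0) {X Y : Ω → ℝ} (hX : Measurable X)
    (hXb : ∀ ω, |X ω| ≤ 1) (h : μ[X | m] =ᵐ[μ] Y) (ξ : Ω → ℝ) (C : ℝ) (hξ : Measurable[m] ξ)
    (hξb : ∀ ω, |ξ ω| ≤ C) : ∫ ω, ξ ω * X ω ∂μ = ∫ ω, ξ ω * Y ω ∂μ := by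
  have hξ0 : Measurable ξ := hξ.mono hm le_rfl
  have iX : Integrable X μ := ib' 1 hX hXb
  have iξX : Integrable (ξ * X) μ := by
    have : Integrable ξ μ := ib' C hξ0 hξb
    exact this.mul_bdd (c := 1) hX.aestronglyMeasurable (ae_of_all _ hXb)
  have h1 := condExp_mul_of_stronglyMeasurable_left hξ.stronglyMeasurable iξX iX
  have h2 : ∫ ω, (μ[ξ * X | m]) ω ∂μ = ∫ ω, (ξ * X) ω ∂μ := integral_condExp hm
  change ∫ ω, (ξ * X) ω ∂μ = _
  rw [← h2]
  refine integral_congr_ae ?_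
  filter_upwards [h1, h] with ω a1 a2
  rw [a1, Pi.mul_apply, a2]

lemma alg_d {N : ℕ} (hN : 1 ≤ N) (z : Fin N → ℝ) : ∑ i, (z i - (∑ j, z j) / N) = 0 := by
  have : (N : ℝ) ≠ 0 := by positivity
  rw [Finset.sum_sub_distrib, Finset.sum_const, Finset.card_univ, Fintype.card_fin, nsmul_eq_mul]
  field_simp; ring

lemma alg_p {N : ℕ} (hN : 1 ≤ N) (z : Fin N → ℝ) (α : ℝ) :
    ∑ i, ((1 - α) * z i + α * ((∑ j, z j) / N)) = ∑ j, z j := by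
  have : (N : ℝ) ≠ 0 := by positivity
  rw [Finset.sum_add_distrib, ← Finset.mul_sum, Finset.sum_const, Finset.card_univ,
    Fintype.card_fin, nsmul_eq_mul]
  field_simp; ring

/-- sum of squares around the mean is the smallest, and its expansion -/
lemma alg_sq {N : ℕ} (hN : 1 ≤ N) (z : Fin N → ℝ) :
    ∑ i, (z i - (∑ j, z j) / N) ^ 2 = ∑ i, z i ^ 2 - N * ((∑ j, z j) / N) ^ 2 := by
  have : (N : ℝ) ≠ 0 := by positivity
  have e : ∀ i, (z i - (∑ j, z j) / N) ^ 2
      = z i ^ 2 - 2 * ((∑ j, z j) / N) * z i + ((∑ j, z j) / N) ^ 2 := fun i => by ring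
  simp_rw [e]
  rw [Finset.sum_add_distrib, Finset.sum_sub_distrib, ← Finset.mul_sum, Finset.sum_const,
    Finset.card_univ, Fintype.card_fin, nsmul_eq_mul]
  field_simp; ring

lemma alg_pp {N : ℕ} (hN : 1 ≤ N) (z : Fin N → ℝ) (α : ℝ) :
    ∑ i, ((1 - α) * z i + α * ((∑ j, z j) / N)) * (1 - ((1 - α) * z i + α * ((∑ j, z j) / N)))
      = N * ((∑ j, z j) / N * (1 - (∑ j, z j) / N))
        - (1 - α) ^ 2 * ∑ i, (z i - (∑ j, z j) / N) ^ 2 := by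
  have hd := alg_d hN z
  set m := (∑ j, z j) / N with hm
  have e : ∀ i, ((1 - α) * z i + α * m) * (1 - ((1 - α) * z i + α * m))
      = m * (1 - m) + (1 - α) * (1 - 2 * m) * (z i - m) - (1 - α) ^ 2 * (z i - m) ^ 2 :=
    fun i => by ring
  simp_rw [e]
  rw [Finset.sum_sub_distrib, Finset.sum_add_distrib, ← Finset.mul_sum (f := fun i => z i - m),
    ← Finset.mul_sum (f := fun i => (z i - m) ^ 2), hd,
    Finset.sum_const, Finset.card_univ, Fintype.card_fin, nsmul_eq_mul]
  ring

lemma alg_rec {N : ℕ} (hN : 1 ≤ N) (z e : Fin N → ℝ) (α r : ℝ) (he : ∀ i, |e i| ≤ 1)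
    (ha : 0 ≤ α ∧ α ≤ 1) (hr : 0 ≤ r ∧ r < 1) (w : Fin N → ℝ)
    (hw : ∀ i, w i = (1 - r) * z i + r * (e i + ((1 - α) * z i + α * ((∑ j, z j) / N)))) :
    ∑ i, (w i - (∑ j, w j) / N) ^ 2 ≤ (1 - α * r) * ∑ i, (z i - (∑ j, z j) / N) ^ 2 + N * r ^ 2
      + ∑ i, 2 * r * (1 - α * r) * ((z i - (∑ j, z j) / N) * e i) := by
  have hN0 : (N : ℝ) ≠ 0 := by positivity
  have hd := alg_d hN z
  have hp := alg_p hN z α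
  have hsw : (∑ j, w j) / N = (∑ j, z j) / N + r * ((∑ j, e j) / N) := by
    have : ∑ j, w j = (1 - r) * ∑ j, z j + r * (∑ j, e j + ∑ j, z j) := by
      simp_rw [hw]
      rw [Finset.sum_add_distrib, ← Finset.mul_sum, ← Finset.mul_sum, Finset.sum_add_distrib, hp]
    rw [this]; field_simp; ring
  set m := (∑ j, z j) / N with hm
  have hq := alg_sq hN e
  have hed := alg_d hN e
  set eb := (∑ j, e j) / N with heb
  have x : ∀ i, (w i - (∑ j, w j) / N) ^ 2 = (1 - α * r) ^ 2 * (z i - m) ^ 2 + r ^ 2 * (e i - eb) ^ 2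
      + 2 * r * (1 - α * r) * ((z i - m) * e i) - 2 * r * (1 - α * r) * eb * (z i - m) := by
    intro i; rw [hsw, hw i]; ring
  simp_rw [x]
  rw [Finset.sum_sub_distrib, Finset.sum_add_distrib, Finset.sum_add_distrib, ← Finset.mul_sum,
    ← Finset.mul_sum, ← Finset.mul_sum (f := fun i => z i - m), hd, hq]
  have h1 : ∑ i, e i ^ 2 ≤ N := by
    calc ∑ i, e i ^ 2 ≤ ∑ i : Fin N, (1 : ℝ) := Finset.sum_le_sum fun i _ => by
          have := sq_abs (e i); nlinarith [he i, abs_nonneg (e i)]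
      _ = N := by simp
  have h2 : 0 ≤ ∑ i, (z i - m) ^ 2 := Finset.sum_nonneg fun i _ => sq_nonneg _
  have har : 0 ≤ α * r := mul_nonneg ha.1 hr.1
  have har1 : α * r ≤ 1 := by nlinarith
  have h3 : (1 - α * r) ^ 2 * ∑ i, (z i - m) ^ 2 ≤ (1 - α * r) * ∑ i, (z i - m) ^ 2 := by
    apply mul_le_mul_of_nonneg_right _ h2; nlinarith
  have h4 : r ^ 2 * (∑ i, e i ^ 2 - N * eb ^ 2) ≤ N * r ^ 2 := by
    have : ∑ i, e i ^ 2 - N * eb ^ 2 ≤ N := by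
      have : 0 ≤ (N : ℝ) * eb ^ 2 := by positivity
      linarith
    nlinarith [sq_nonneg r]
  linarith

section
variable {Ω : Type*} {m : MeasurableSpace Ω} [m0 : MeasurableSpace Ω] {μ : Measure Ω} [IsProbabilityMeasure μ]

lemma mom1 (hm : m ≤ m0) {N : ℕ} {p J : Fin N → Ω → ℝ}
    (hJ : ∀ i, Measurable (J i)) (hp : ∀ i, Measurable[m] (p i))
    (hJ01 : ∀ i ω, J i ω = 0 ∨ J i ω = 1) (hp01 : ∀ i ω, 0 ≤ p i ω ∧ p i ω ≤ 1)
    (hc : ∀ s : Finset (Fin N), μ[(fun ω => ∏ i ∈ s, J i ω) | m] =ᵐ[μ] fun ω => ∏ i ∈ s, p i ω)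
    (i : Fin N) (ξ : Ω → ℝ) (C : ℝ) (hξ : Measurable[m] ξ) (hξb : ∀ ω, |ξ ω| ≤ C) :
    ∫ ω, ξ ω * (J i ω - p i ω) ∂μ = 0 := by
  have hξ0 : Measurable ξ := hξ.mono hm le_rfl
  have hp0 : Measurable (p i) := (hp i).mono hm le_rfl
  have hJb : ∀ ω, |J i ω| ≤ 1 := fun ω => by rcases hJ01 i ω with h | h <;> simp [h]
  have hpb : ∀ ω, |p i ω| ≤ 1 := fun ω => abs_le.2 ⟨by linarith [(hp01 i ω).1], (hp01 i ω).2⟩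
  have h := int_cond hm (hJ i) hJb (Y := p i) (by simpa using hc {i}) ξ C hξ hξb
  have key : ∀ g : Ω → ℝ, Measurable g → (∀ ω, |g ω| ≤ 1) → Integrable (fun ω => ξ ω * g ω) μ := by
    intro g hg hgb
    refine ib' (C * 1) (hξ0.mul hg) fun ω => ?_
    rw [abs_mul]
    exact mul_le_mul (hξb ω) (hgb ω) (abs_nonneg _) ((abs_nonneg _).trans (hξb ω))
  simp_rw [mul_sub]
  rw [integral_sub (key _ (hJ i) hJb) (key _ hp0 hpb), h, sub_self]

lemma mom2 (hm : m ≤ m0) {N : ℕ} {p J : Fin N → Ω → ℝ}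
    (hJ : ∀ i, Measurable (J i)) (hp : ∀ i, Measurable[m] (p i))
    (hJ01 : ∀ i ω, J i ω = 0 ∨ J i ω = 1) (hp01 : ∀ i ω, 0 ≤ p i ω ∧ p i ω ≤ 1)
    (hc : ∀ s : Finset (Fin N), μ[(fun ω => ∏ i ∈ s, J i ω) | m] =ᵐ[μ] fun ω => ∏ i ∈ s, p i ω)
    (i j : Fin N) (ξ : Ω → ℝ) (C : ℝ) (hξ : Measurable[m] ξ) (hξb : ∀ ω, |ξ ω| ≤ C) :
    ∫ ω, ξ ω * ((J i ω - p i ω) * (J j ω - p j ω)) ∂μ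
      = if i = j then ∫ ω, ξ ω * (p i ω * (1 - p i ω)) ∂μ else 0 := by
  have hξ0 : Measurable ξ := hξ.mono hm le_rfl
  have hp0 : ∀ i, Measurable (p i) := fun i => (hp i).mono hm le_rfl
  have hJb : ∀ i ω, |J i ω| ≤ 1 := fun i ω => by rcases hJ01 i ω with h | h <;> simp [h]
  have hpb : ∀ i ω, |p i ω| ≤ 1 := fun i ω =>
    abs_le.2 ⟨by linarith [(hp01 i ω).1], (hp01 i ω).2⟩
  have hC : ∀ ω : Ω, 0 ≤ C := fun ω => (abs_nonneg _).trans (hξb ω)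
  have bm : ∀ {a b A B : ℝ}, |a| ≤ A → |b| ≤ B → |a * b| ≤ A * B := by
    intro a b A B h1 h2
    rw [abs_mul]
    exact mul_le_mul h1 h2 (abs_nonneg _) ((abs_nonneg _).trans h1)
  have key : ∀ (D : ℝ) (g : Ω → ℝ), Measurable g → (∀ ω, |g ω| ≤ D) →
      Integrable (fun ω => ξ ω * g ω) μ := by
    intro D g hg hgb
    exact ib' (C * D) (hξ0.mul hg) fun ω => bm (hξb ω) (hgb ω)
  have eb : ∀ i ω, |J i ω - p i ω| ≤ 1 := fun i ω => by
    have := hp01 i ω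
    rcases hJ01 i ω with h | h <;> rw [h, abs_le] <;> constructor <;> linarith
  by_cases hij : i = j
  · subst hij
    rw [if_pos rfl]
    have h1 := mom1 hm hJ hp hJ01 hp01 hc i (fun ω => ξ ω * (1 - 2 * p i ω)) (C * 3)
      (hξ.mul (measurable_const.sub ((hp i).const_mul 2)))
      (fun ω => bm (hξb ω) (abs_le.2 ⟨by linarith [(hp01 i ω).1, (hp01 i ω).2],
        by linarith [(hp01 i ω).1, (hp01 i ω).2]⟩))
    have e : ∀ ω, ξ ω * ((J i ω - p i ω) * (J i ω - p i ω))
        = ξ ω * (1 - 2 * p i ω) * (J i ω - p i ω) + ξ ω * (p i ω * (1 - p i ω)) := by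
      intro ω
      rcases hJ01 i ω with h | h <;> rw [h] <;> ring
    simp_rw [e]
    rw [integral_add, h1, zero_add]
    · refine ib' (C * 3 * 1) ?_ fun ω => bm (bm (hξb ω) (abs_le.2 ⟨by linarith [(hp01 i ω).1, (hp01 i ω).2],
        by linarith [(hp01 i ω).1, (hp01 i ω).2]⟩)) (eb i ω)
      exact (hξ0.mul (measurable_const.sub ((hp0 i).const_mul 2))).mul ((hJ i).sub (hp0 i))
    · refine key (1 * 1) _ ((hp0 i).mul (measurable_const.sub (hp0 i))) fun ω => bm (hpb i ω)
        (abs_le.2 ⟨by linarith [(hp01 i ω).1, (hp01 i ω).2],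
        by linarith [(hp01 i ω).1, (hp01 i ω).2]⟩)
  · rw [if_neg hij]
    have hY : μ[(fun ω => J i ω * J j ω) | m] =ᵐ[μ] fun ω => p i ω * p j ω := by
      have := hc {i, j}
      simpa [Finset.prod_pair hij] using this
    have h1 := int_cond hm ((hJ i).mul (hJ j)) (fun ω => by simpa using bm (hJb i ω) (hJb j ω))
      hY ξ C hξ hξb
    have h2 := mom1 hm hJ hp hJ01 hp01 hc i (fun ω => ξ ω * p j ω) (C * 1) (hξ.mul (hp j))
      (fun ω => bm (hξb ω) (hpb j ω))
    have h3 := mom1 hm hJ hp hJ01 hp01 hc j (fun ω => ξ ω * p i ω) (C * 1) (hξ.mul (hp i))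
      (fun ω => bm (hξb ω) (hpb i ω))
    have e : ∀ ω, ξ ω * ((J i ω - p i ω) * (J j ω - p j ω))
        = (ξ ω * (J i ω * J j ω) - ξ ω * (p i ω * p j ω))
          - (ξ ω * p j ω * (J i ω - p i ω) + ξ ω * p i ω * (J j ω - p j ω)) := by
      intro ω; ring
    simp_rw [e]
    have i1 := key (1 * 1) (fun ω => J i ω * J j ω) ((hJ i).mul (hJ j)) (fun ω => bm (hJb i ω) (hJb j ω))
    have i2 := key (1 * 1) (fun ω => p i ω * p j ω) ((hp0 i).mul (hp0 j)) (fun ω => bm (hpb i ω) (hpb j ω))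
    have i3 : Integrable (fun ω => ξ ω * p j ω * (J i ω - p i ω)) μ :=
      ib' (C * 1 * 1) ((hξ0.mul (hp0 j)).mul ((hJ i).sub (hp0 i)))
        fun ω => bm (bm (hξb ω) (hpb j ω)) (eb i ω)
    have i4 : Integrable (fun ω => ξ ω * p i ω * (J j ω - p j ω)) μ :=
      ib' (C * 1 * 1) ((hξ0.mul (hp0 i)).mul ((hJ j).sub (hp0 j)))
        fun ω => bm (bm (hξb ω) (hpb i ω)) (eb j ω)
    rw [integral_sub (by exact i1.sub i2) (by exact i3.add i4), integral_sub i1 i2, integral_add i3 i4, h2, h3]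
    simp only [Pi.mul_apply] at *
    rw [h1]; ring

end
lemma walk_meas {Ω : Type*} [m0 : MeasurableSpace Ω] {N : ℕ} (Z : ℕ → Fin N → Ω → ℝ) (n k : ℕ)
    (hk : k ≤ n) (i : Fin N) : Measurable[walkFiltration Z n] (Z k i) := by
  have h1 : MeasurableSpace.comap (Z k i) (borel ℝ) ≤ walkFiltration Z n := by
    unfold walkFiltration
    refine le_trans ?_ (le_iSup₂ (f := fun k (_ : k ∈ Finset.range (n + 1)) =>
      ⨆ i : Fin N, MeasurableSpace.comap (Z k i) (borel ℝ)) k (Finset.mem_range.2 (by omega)))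
    exact le_iSup (fun i : Fin N => MeasurableSpace.comap (Z k i) (borel ℝ)) i
  have h2 : MeasurableSpace.comap (Z k i) (inferInstance : MeasurableSpace ℝ)
      ≤ walkFiltration Z n := by
    have : (inferInstance : MeasurableSpace ℝ) = borel ℝ := BorelSpace.measurable_eq
    rw [this]; exact h1
  exact measurable_iff_comap_le.2 h2

/-- the filtration -/
def walkF {Ω : Type*} [m0 : MeasurableSpace Ω] {N : ℕ} (Z : ℕ → Fin N → Ω → ℝ)
    (hZ : ∀ n i, Measurable (Z n i)) : Filtration ℕ m0 where
  seq := walkFiltration Z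
  mono' := by
    intro a b hab
    unfold walkFiltration
    refine iSup₂_le fun k hk => ?_
    exact le_iSup₂ (f := fun k (_ : k ∈ Finset.range (b + 1)) =>
      ⨆ i : Fin N, MeasurableSpace.comap (Z k i) (borel ℝ)) k
      (Finset.mem_range.2 (by have := Finset.mem_range.1 hk; omega))
  le' := by
    intro n
    unfold walkFiltration
    refine iSup₂_le fun k _ => iSup_le fun i => ?_
    have : (inferInstance : MeasurableSpace ℝ) = borel ℝ := BorelSpace.measurable_eq
    rw [← this]
    exact measurable_iff_comap_le.1 (hZ k i)

lemma walk_sys {Ω : Type*} [m0 : MeasurableSpace Ω] {μ : Measure Ω} [IsProbabilityMeasure μ]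
    {N : ℕ} (hN : 1 ≤ N) (α : ℝ) (hα : 0 < α ∧ α ≤ 1)
    (r : ℕ → ℝ) (hr : ∀ n, 0 ≤ r n ∧ r n < 1)
    (Z : ℕ → Fin N → Ω → ℝ) (I : ℕ → Fin N → Ω → ℝ)
    (hZmeas : ∀ n i, Measurable (Z n i))
    (hImeas : ∀ n i, Measurable (I n i))
    (hZ01 : ∀ n i ω, Z n i ω ∈ Set.Icc (0:ℝ) 1)
    (hI01 : ∀ n i ω, I n i ω = 0 ∨ I n i ω = 1)
    (hdyn : ∀ n i ω, Z (n + 1) i ω = (1 - r n) * Z n i ω + r n * I n i ω)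
    (hcond : ∀ n (s : Finset (Fin N)),
      μ[(fun ω => ∏ i ∈ s, I n i ω) | walkFiltration Z n]
        =ᵐ[μ] fun ω => ∏ i ∈ s, ((1 - α) * Z n i ω + α * walkMean Z n ω)) :
    Sys μ (walkF Z hZmeas) r (walkMean Z)
      (fun n ω => ∑ i, (Z n i ω - walkMean Z n ω) ^ 2) α (1 / N) ((1 - α) ^ 2 / N ^ 2) N := by
  have hN0 : (N : ℝ) ≠ 0 := by positivity
  have hN1 : (1 : ℝ) ≤ N := by exact_mod_cast hN
  have hNp : (0 : ℝ) < N := by positivity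
  have zM : ∀ n i, Measurable[walkF Z hZmeas n] (Z n i) := fun n i => walk_meas Z n n le_rfl i
  have mM : ∀ n, Measurable[walkF Z hZmeas n] (walkMean Z n) := by
    intro n
    unfold walkMean
    exact (Finset.measurable_sum _ fun i _ => zM n i).div_const _
  have dM : ∀ n i, Measurable[walkF Z hZmeas n] (fun ω => Z n i ω - walkMean Z n ω) :=
    fun n i => (zM n i).sub (mM n)
  have lM : ∀ n, Measurable[walkF Z hZmeas n] (fun ω => ∑ i, (Z n i ω - walkMean Z n ω) ^ 2) :=
    fun n => Finset.measurable_sum _ fun i _ => (dM n i).pow_const 2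
  have pM : ∀ n i, Measurable[walkF Z hZmeas n]
      (fun ω => (1 - α) * Z n i ω + α * walkMean Z n ω) :=
    fun n i => ((zM n i).const_mul _).add ((mM n).const_mul _)
  have m01 : ∀ n ω, 0 ≤ walkMean Z n ω ∧ walkMean Z n ω ≤ 1 := by
    intro n ω
    unfold walkMean
    constructor
    · exact div_nonneg (Finset.sum_nonneg fun i _ => (hZ01 n i ω).1) hNp.le
    · rw [div_le_one hNp]
      calc ∑ i, Z n i ω ≤ ∑ i : Fin N, (1 : ℝ) := Finset.sum_le_sum fun i _ => (hZ01 n i ω).2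
        _ = N := by simp
  have p01 : ∀ n i ω, 0 ≤ (1 - α) * Z n i ω + α * walkMean Z n ω ∧
      (1 - α) * Z n i ω + α * walkMean Z n ω ≤ 1 := by
    intro n i ω
    have h1 := hZ01 n i ω
    have h2 := m01 n ω
    constructor
    · have := mul_nonneg (sub_nonneg.2 hα.2) h1.1
      have := mul_nonneg hα.1.le h2.1
      linarith
    · nlinarith [mul_le_mul_of_nonneg_left h1.2 (sub_nonneg.2 hα.2),
        mul_le_mul_of_nonneg_left h2.2 hα.1.le]
  have db : ∀ n i ω, |Z n i ω - walkMean Z n ω| ≤ 1 := fun n i ω => by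
    have h1 := hZ01 n i ω
    have h2 := m01 n ω
    exact abs_le.2 ⟨by linarith [h1.1], by linarith [h1.2]⟩
  have bm : ∀ {a b A B : ℝ}, |a| ≤ A → |b| ≤ B → |a * b| ≤ A * B := by
    intro a b A B h1 h2
    rw [abs_mul]
    exact mul_le_mul h1 h2 (abs_nonneg _) ((abs_nonneg _).trans h1)
  -- increments
  set e : ℕ → Fin N → Ω → ℝ := fun n i ω => I n i ω - ((1 - α) * Z n i ω + α * walkMean Z n ω)
    with he
  have le : ∀ n, walkF Z hZmeas n ≤ m0 := (walkF Z hZmeas).le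
  have eM : ∀ n i, Measurable (e n i) := fun n i =>
    (hImeas n i).sub ((pM n i).mono (le n) le_rfl)
  have eb : ∀ n i ω, |e n i ω| ≤ 1 := fun n i ω => by
    have := p01 n i ω
    simp only [he]
    rcases hI01 n i ω with h | h <;> rw [h, abs_le] <;> constructor <;> linarith
  have m1 : ∀ n i ξ C, Measurable[walkF Z hZmeas n] ξ → (∀ ω, |ξ ω| ≤ C) →
      ∫ ω, ξ ω * e n i ω ∂μ = 0 := fun n i ξ C h1 h2 =>
    mom1 (le n) (hImeas n) (pM n) (hI01 n) (p01 n) (hcond n) i ξ C h1 h2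
  have m2 : ∀ n i j ξ C, Measurable[walkF Z hZmeas n] ξ → (∀ ω, |ξ ω| ≤ C) →
      ∫ ω, ξ ω * (e n i ω * e n j ω) ∂μ
        = if i = j then ∫ ω, ξ ω * (((1 - α) * Z n i ω + α * walkMean Z n ω)
          * (1 - ((1 - α) * Z n i ω + α * walkMean Z n ω))) ∂μ else 0 := fun n i j ξ C h1 h2 =>
    mom2 (le n) (hImeas n) (pM n) (hI01 n) (p01 n) (hcond n) i j ξ C h1 h2
  have hw : ∀ n i ω, Z (n + 1) i ω = (1 - r n) * Z n i ω
      + r n * (e n i ω + ((1 - α) * Z n i ω + α * walkMean Z n ω)) := fun n i ω => by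
    rw [hdyn]; simp only [he]; ring
  have hinc : ∀ n ω, walkMean Z (n + 1) ω - walkMean Z n ω = r n / N * ∑ i, e n i ω := by
    intro n ω
    have hp := alg_p hN (fun i => Z n i ω) α
    have : ∑ i, Z (n + 1) i ω = (1 - r n) * ∑ i, Z n i ω
        + r n * (∑ i, e n i ω + ∑ i, Z n i ω) := by
      simp_rw [hw]
      rw [Finset.sum_add_distrib, ← Finset.mul_sum, ← Finset.mul_sum, Finset.sum_add_distrib]
      congr 3
    unfold walkMean
    rw [this]; field_simp; ring
  have iξ : ∀ (ξ : Ω → ℝ) (C D : ℝ) (g : Ω → ℝ), Measurable ξ → (∀ ω, |ξ ω| ≤ C) →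
      Measurable g → (∀ ω, |g ω| ≤ D) → Integrable (fun ω => ξ ω * g ω) μ := by
    intro ξ C D g h1 h2 h3 h4
    exact ib' (C * D) (h1.mul h3) fun ω => bm (h2 ω) (h4 ω)
  refine ⟨hr, hα, ⟨by positivity, ?_⟩, ⟨by positivity, ?_⟩, hNp.le, mM, lM, m01, ?_, ?_, ?_, ?_, ?_⟩
  · rw [div_le_one hNp]; exact hN1
  · rw [div_le_one (by positivity)]
    nlinarith [hα.1, hα.2]
  · intro n ω
    refine ⟨Finset.sum_nonneg fun i _ => sq_nonneg _, ?_⟩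
    calc ∑ i, (Z n i ω - walkMean Z n ω) ^ 2 ≤ ∑ i : Fin N, (1 : ℝ) :=
          Finset.sum_le_sum fun i _ => by
            rw [← sq_abs]; exact pow_le_one₀ (abs_nonneg _) (db n i ω)
      _ = N := by simp
  · intro n ω
    rw [hinc, abs_mul, abs_of_nonneg (div_nonneg (hr n).1 hNp.le)]
    have : |∑ i, e n i ω| ≤ N := by
      calc |∑ i, e n i ω| ≤ ∑ i, |e n i ω| := Finset.abs_sum_le_sum_abs _ _
        _ ≤ ∑ i : Fin N, (1 : ℝ) := Finset.sum_le_sum fun i _ => eb n i ω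
        _ = N := by simp
    calc r n / N * |∑ i, e n i ω| ≤ r n / N * N :=
          mul_le_mul_of_nonneg_left this (div_nonneg (hr n).1 hNp.le)
      _ = r n := by field_simp
  · intro n ξ C h1 h2
    have h10 : Measurable ξ := h1.mono (le n) le_rfl
    have e1 : ∀ ω, ξ ω * (walkMean Z (n + 1) ω - walkMean Z n ω)
        = r n / N * ∑ i, ξ ω * e n i ω := fun ω => by
      rw [hinc, ← Finset.mul_sum]; ring
    simp_rw [e1]
    rw [integral_const_mul, integral_finsetSum _ fun i _ => iξ ξ C 1 _ h10 h2 (eM n i) (eb n i)]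
    rw [Finset.sum_eq_zero fun i _ => m1 n i ξ C h1 h2, mul_zero]
  · intro n ξ C h1 h2
    have h10 : Measurable ξ := h1.mono (le n) le_rfl
    have iee : ∀ i j, Integrable (fun ω => ξ ω * (e n i ω * e n j ω)) μ := fun i j =>
      iξ ξ C (1 * 1) _ h10 h2 ((eM n i).mul (eM n j)) fun ω => bm (eb n i ω) (eb n j ω)
    have pM0 : ∀ i, Measurable (fun ω => (1 - α) * Z n i ω + α * walkMean Z n ω) :=
      fun i => (pM n i).mono (le n) le_rfl
    have ipp : ∀ i, Integrable (fun ω => ξ ω * (((1 - α) * Z n i ω + α * walkMean Z n ω)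
          * (1 - ((1 - α) * Z n i ω + α * walkMean Z n ω)))) μ := fun i =>
      iξ ξ C (1 * 1) _ h10 h2 ((pM0 i).mul (measurable_const.sub (pM0 i))) fun ω => by
        have := p01 n i ω
        exact bm (abs_le.2 ⟨by linarith, by linarith⟩) (abs_le.2 ⟨by linarith, by linarith⟩)
    have e1 : ∀ ω, ξ ω * (walkMean Z (n + 1) ω - walkMean Z n ω) ^ 2
        = (r n / N) ^ 2 * ∑ i, ∑ j, ξ ω * (e n i ω * e n j ω) := fun ω => by
      simp_rw [← Finset.mul_sum]
      rw [hinc, ← Finset.sum_mul]; ring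
    have e2 : ∀ ω, ξ ω * (r n ^ 2 * (1 / N * (walkMean Z n ω * (1 - walkMean Z n ω))
          - (1 - α) ^ 2 / N ^ 2 * ∑ i, (Z n i ω - walkMean Z n ω) ^ 2))
        = (r n / N) ^ 2 * ∑ i, ξ ω * (((1 - α) * Z n i ω + α * walkMean Z n ω)
          * (1 - ((1 - α) * Z n i ω + α * walkMean Z n ω))) := fun ω => by
      have := alg_pp hN (fun i => Z n i ω) α
      change ∑ i, ((1 - α) * Z n i ω + α * walkMean Z n ω)
          * (1 - ((1 - α) * Z n i ω + α * walkMean Z n ω)) = N * (walkMean Z n ω *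
          (1 - walkMean Z n ω)) - (1 - α) ^ 2 * ∑ i, (Z n i ω - walkMean Z n ω) ^ 2 at this
      rw [← Finset.mul_sum, this]
      field_simp
    simp_rw [e1, e2]
    rw [integral_const_mul, integral_const_mul, integral_finsetSum _ fun i _ =>
      integrable_finsetSum _ fun j _ => iee i j, integral_finsetSum _ fun i _ => ipp i]
    congr 1
    refine Finset.sum_congr rfl fun i _ => ?_
    rw [integral_finsetSum _ fun j _ => iee i j]
    simp_rw [m2 n i _ ξ C h1 h2]
    simp
  · intro n ξ C h1 h2
    have h10 : Measurable ξ := h1.mono (le n) le_rfl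
    have h2b : ∀ ω, |ξ ω| ≤ C := fun ω => by rw [abs_of_nonneg (h2 ω).1]; exact (h2 ω).2
    have lb : ∀ n ω, |∑ i, (Z n i ω - walkMean Z n ω) ^ 2| ≤ N := by
      intro n ω
      rw [abs_of_nonneg (Finset.sum_nonneg fun i _ => sq_nonneg _)]
      calc ∑ i, (Z n i ω - walkMean Z n ω) ^ 2 ≤ ∑ i : Fin N, (1 : ℝ) :=
            Finset.sum_le_sum fun i _ => by
              rw [← sq_abs]; exact pow_le_one₀ (abs_nonneg _) (db n i ω)
        _ = N := by simp
    have lM0 : ∀ n, Measurable (fun ω => ∑ i, (Z n i ω - walkMean Z n ω) ^ 2) :=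
      fun n => (lM n).mono (le n) le_rfl
    have dM0 : ∀ i, Measurable (fun ω => Z n i ω - walkMean Z n ω) :=
      fun i => (dM n i).mono (le n) le_rfl
    have ide : ∀ i, Integrable (fun ω => ξ ω * (Z n i ω - walkMean Z n ω) * e n i ω) μ := fun i =>
      iξ _ (C * 1) 1 _ (h10.mul (dM0 i)) (fun ω => bm (h2b ω) (db n i ω)) (eM n i) (eb n i)
    have hz : ∫ ω, 2 * r n * (1 - α * r n)
        * ∑ i, ξ ω * (Z n i ω - walkMean Z n ω) * e n i ω ∂μ = 0 := by
      rw [integral_const_mul, integral_finsetSum _ fun i _ => ide i,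
        Finset.sum_eq_zero fun i _ => m1 n i (fun ω => ξ ω * (Z n i ω - walkMean Z n ω)) (C * 1)
          (h1.mul (dM n i))
          (fun ω => bm (h2b ω) (db n i ω)), mul_zero]
    have ia : Integrable (fun ω => ξ ω * ((1 - α * r n) * ∑ i, (Z n i ω - walkMean Z n ω) ^ 2
        + N * r n ^ 2)) μ := by
      refine iξ ξ C (|1 - α * r n| * N + |N * r n ^ 2|) _ h10 h2b
        (((lM0 n).const_mul _).add_const _) fun ω => ?_
      exact (abs_add_le _ _).trans (add_le_add (bm le_rfl (lb n ω)) le_rfl)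
    have ib : Integrable (fun ω => 2 * r n * (1 - α * r n)
        * ∑ i, ξ ω * (Z n i ω - walkMean Z n ω) * e n i ω) μ :=
      (integrable_finsetSum _ fun i _ => ide i).const_mul _
    rw [← add_zero (∫ ω, ξ ω * ((1 - α * r n) * ∑ i, (Z n i ω - walkMean Z n ω) ^ 2
        + N * r n ^ 2) ∂μ), ← hz, ← integral_add ia ib]
    refine integral_mono (iξ ξ C N _ h10 h2b (lM0 (n + 1)) (lb (n + 1))) (ia.add ib) fun ω => ?_
    have := alg_rec hN (fun i => Z n i ω) (fun i => e n i ω) α (r n) (fun i => eb n i ω)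
      ⟨hα.1.le, hα.2⟩ (hr n) (fun i => Z (n + 1) i ω) (fun i => hw n i ω)
    have h3 := mul_le_mul_of_nonneg_left this (h2 ω).1
    refine h3.trans (le_of_eq ?_)
    rw [mul_add]
    refine congrArg₂ (· + ·) rfl ?_
    rw [Finset.mul_sum, Finset.mul_sum]
    refine Finset.sum_congr rfl fun i _ => ?_
    change ξ ω * (2 * r n * (1 - α * r n) * ((Z n i ω - walkMean Z n ω) * e n i ω)) = _
    ring

/-- **Proposition (a.s. conditional CLT)**: for `ρ = 1`, `α > 0` and `n^γ r_n → c > 0`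
with `1/2 < γ ≤ 1`, the variables `n^{γ-1/2}(Z_n - Z)` converge to the Gaussian kernel
`N(0, c² Z(1-Z)/(N(2γ-1)))` in the sense of almost sure conditional convergence w.r.t.
the filtration `(F_n)`: for every bounded continuous `f`, `E[f(n^{γ-1/2}(Z_n - Z)) | F_n]`
converges a.s. to `∫ f dN(0, c² Z(1-Z)/(N(2γ-1)))`. -/
theorem stmt_6
    {Ω : Type*} [MeasurableSpace Ω] (μ : Measure Ω) [IsProbabilityMeasure μ]
    (N : ℕ) (hN : 1 ≤ N)
    (ρ α q : ℝ)
    (hρ : ρ ∈ Set.Icc (0:ℝ) 1) (hα : α ∈ Set.Icc (0:ℝ) 1) (hq : q ∈ Set.Icc (0:ℝ) 1)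
    (r : ℕ → ℝ) (hr : ∀ n, 0 ≤ r n ∧ r n < 1)
    (Z : ℕ → Fin N → Ω → ℝ) (I : ℕ → Fin N → Ω → ℝ)
    (hZmeas : ∀ n i, Measurable (Z n i))
    (hImeas : ∀ n i, Measurable (I n i))
    (hZ01 : ∀ n i ω, Z n i ω ∈ Set.Icc (0:ℝ) 1)
    (hI01 : ∀ n i ω, I n i ω = 0 ∨ I n i ω = 1)
    -- dynamics: `Z_{n+1}(i) = (1 - r_n) Z_n(i) + r_n (ρ I_{n+1}(i) + (1-ρ) q)`
    -- (here `I n i` stands for `I_{n+1}(i)`)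
    (hdyn : ∀ n i ω, Z (n + 1) i ω
      = (1 - r n) * Z n i ω + r n * (ρ * I n i ω + (1 - ρ) * q))
    -- conditional independence of `I_{n+1}(1), …, I_{n+1}(N)` given `F_n`, together with
    -- the conditional law `P(I_{n+1}(i) = 1 | F_n) = (1-α) Z_n(i) + α Z_n`, expressed
    -- (equivalently, for {0,1}-valued variables) through conditional product moments
    (hcond : ∀ n (s : Finset (Fin N)),
      μ[(fun ω => ∏ i ∈ s, I n i ω) | walkFiltration Z n]
        =ᵐ[μ] fun ω => ∏ i ∈ s, ((1 - α) * Z n i ω + α * walkMean Z n ω))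
    -- the initial configuration is permutation invariant with mean 1/2 and E[Z_0(1-Z_0)] > 0
    (hperm : ∀ σ : Equiv.Perm (Fin N),
      μ.map (fun ω (i : Fin N) => Z 0 (σ i) ω) = μ.map (fun ω (i : Fin N) => Z 0 i ω))
    (hmean0 : ∀ i, ∫ ω, Z 0 i ω ∂μ = 1 / 2)
    (hvar0 : 0 < ∫ ω, walkMean Z 0 ω * (1 - walkMean Z 0 ω) ∂μ)
    (hρ1 : ρ = 1) (hα0 : 0 < α)
    (c γ : ℝ) (hc : 0 < c) (hγ : 1/2 < γ ∧ γ ≤ 1)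
    (hlim : Tendsto (fun n : ℕ => (n : ℝ) ^ γ * r n) atTop (nhds c))
    (Zlim : Ω → ℝ)
    (hZlim : ∀ᵐ ω ∂μ, Tendsto (fun n => walkMean Z n ω) atTop (nhds (Zlim ω))) :
    ∀ f : ℝ → ℝ, Continuous f → (∃ C, ∀ x, |f x| ≤ C) →
      ∀ᵐ ω ∂μ, Tendsto
        (fun n => (μ[(fun ω' => f ((n : ℝ) ^ (γ - 1/2) * (walkMean Z n ω' - Zlim ω')))
            | walkFiltration Z n]) ω)
        atTop
        (nhds (∫ x, f x ∂(ProbabilityTheory.gaussianReal 0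
          (Real.toNNReal (c ^ 2 * Zlim ω * (1 - Zlim ω) / (N * (2 * γ - 1))))))) := by
  intro f hf hfb
  subst hρ1
  have hs := walk_sys (μ := μ) hN α ⟨hα0, hα.2⟩ r hr Z I hZmeas hImeas hZ01 hI01
    (fun n i ω => by rw [hdyn]; ring) hcond
  filter_upwards [hs.clt c γ hc hγ hlim Zlim hZlim f hf hfb] with ω hω
  have hN0 : (N : ℝ) ≠ 0 := by positivity
  have hg : 2 * γ - 1 ≠ 0 := by linarith [hγ.1]
  have e : c ^ 2 * Zlim ω * (1 - Zlim ω) / (N * (2 * γ - 1))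
      = c ^ 2 / (2 * γ - 1) * (1 / N * (Zlim ω * (1 - Zlim ω))) := by
    field_simp
  rw [e]
  exact hω
end
end
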